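/- Let d ≥ 1, K > 0, let f : [0,1]^d → ℝ, and let u ∈ X_4^d(K) satisfy Δu = f on (0,1)^d and u = 0 on ∂[0,1]^d. Then there is a family of functions w_J, indexed by the nonempty subsets J ⊆ {1,…,d} and by dyadic mesh sizes (h_j)_{j∈J} (each h_j = 2^{−l_j}, l_j ∈ ℕ), where w_J(·;(h_j)_{j∈J}) is a continuous real-valued function on the hyperplane set I^{(J)} = {x ∈ [0,1]^d : x_j/h_j ∈ ℤ for all j ∈ J} with sup-norm at most K·m!/96^m (m = |J|), such that for every level vector l ∈ ℕ^d, setting h_k = 2^{−l_k}, and for every point x of the associated grid, u(x) − u_h(x) = Σ_{∅≠J⊆{1,…,d}} w_J(x;(h_j)_{j∈J})·Π_{j∈J} h_j², where u_h is the finite difference solution on that grid. In particular, the function w_J depends only on the mesh sizes h_j for j ∈ J and not on the mesh sizes in the remaining directions. -/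

import Mathlib

/-- Partial derivative of `u` in direction `i` (one-sided within `[0,1]` at the
boundary): `∂ᵢu(x) = d/dt u(x₁,…,t,…,x_d)|_{t = xᵢ}` taken within `[0,1]`. -/
noncomputable def pd (d : ℕ) (i : Fin d) (u : (Fin d → ℝ) → ℝ) : (Fin d → ℝ) → ℝ :=
  fun x => derivWithin (fun t => u (Function.update x i t)) (Set.Icc 0 1) (x i)

/-- Mixed partial derivative `D^α u = ∂₁^{α₁} ⋯ ∂_d^{α_d} u`. -/
noncomputable def mderiv (d : ℕ) (α : Fin d → ℕ) (u : (Fin d → ℝ) → ℝ) :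
    (Fin d → ℝ) → ℝ :=
  (List.finRange d).foldr (fun i v => (pd d i)^[α i] v) u

/-- The closed unit cube `[0,1]^d`. -/
def unitCube (d : ℕ) : Set (Fin d → ℝ) := Set.Icc 0 1

/-- The open unit cube `(0,1)^d`. -/
def openCube (d : ℕ) : Set (Fin d → ℝ) := Set.pi Set.univ fun _ => Set.Ioo (0 : ℝ) 1

/-- The boundary `∂[0,1]^d`. -/
def cubeBdry (d : ℕ) : Set (Fin d → ℝ) := {x ∈ unitCube d | ∃ i, x i = 0 ∨ x i = 1}

/-- All mixed partial derivatives `D^β f`, `β ≤ α`, exist on `s` (each step of the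
iterated differentiation is differentiable within `[0,1]` in its direction). -/
def HasDerivsOn (d : ℕ) (α : Fin d → ℕ) (f : (Fin d → ℝ) → ℝ)
    (s : Set (Fin d → ℝ)) : Prop :=
  ∀ β : Fin d → ℕ, (∀ i, β i ≤ α i) → ∀ i : Fin d, β i < α i → ∀ x ∈ s,
    DifferentiableWithinAt ℝ (fun t => mderiv d β f (Function.update x i t))
      (Set.Icc 0 1) (x i)

/-- `u ∈ X_k^d`: all mixed derivatives `D^α u`, `α ∈ {0,…,k}^d`, exist, are
continuous on `[0,1]^d` and vanish on the boundary. -/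
def MemX (d k : ℕ) (u : (Fin d → ℝ) → ℝ) : Prop :=
  HasDerivsOn d (fun _ => k) u (unitCube d) ∧
  ∀ α : Fin d → ℕ, (∀ i, α i ≤ k) →
    ContinuousOn (mderiv d α u) (unitCube d) ∧
    ∀ x ∈ cubeBdry d, mderiv d α u x = 0

/-- `u ∈ X_k^d(K)`: additionally all these derivatives are bounded by `K`. -/
def MemXb (d k : ℕ) (K : ℝ) (u : (Fin d → ℝ) → ℝ) : Prop :=
  MemX d k u ∧
  ∀ α : Fin d → ℕ, (∀ i, α i ≤ k) → ∀ x ∈ unitCube d, |mderiv d α u x| ≤ K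

/-- Mesh size `h_k = 2^{-lvl_k}` attached to a level vector. -/
noncomputable def hmesh (d : ℕ) (lvl : Fin d → ℕ) (k : Fin d) : ℝ := ((2 : ℝ) ^ lvl k)⁻¹

/-- The grid point with index `i` on the grid of level `lvl`. -/
noncomputable def gridpt (d : ℕ) (lvl : Fin d → ℕ) (i : Fin d → ℕ) : Fin d → ℝ :=
  fun k => (i k : ℝ) * hmesh d lvl k

/-- Valid grid indices: `0 ≤ i_k ≤ 2^{lvl_k}`. -/
def IsGridIdx (d : ℕ) (lvl : Fin d → ℕ) (i : Fin d → ℕ) : Prop := ∀ k, i k ≤ 2 ^ lvl k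

/-- The hyperplane set `I^{(J)} = {x ∈ [0,1]^d : x_j/h_j ∈ ℤ for j ∈ J}`. -/
def Iplane (d : ℕ) (J : Finset (Fin d)) (lvl : Fin d → ℕ) : Set (Fin d → ℝ) :=
  {x ∈ unitCube d | ∀ j ∈ J, ∃ m : ℤ, x j = (m : ℝ) * hmesh d lvl j}

/-- `U` is the central finite difference solution of the Poisson problem `Δu = f`
with zero Dirichlet data on the grid of level `lvl`. -/
def IsFDPoisson (d : ℕ) (lvl : Fin d → ℕ) (f : (Fin d → ℝ) → ℝ)
    (U : (Fin d → ℕ) → ℝ) : Prop :=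
  (∀ i : Fin d → ℕ, IsGridIdx d lvl i → (∃ k, i k = 0 ∨ i k = 2 ^ lvl k) → U i = 0) ∧
  (∀ i : Fin d → ℕ, (∀ k, 1 ≤ i k ∧ i k < 2 ^ lvl k) →
    ∑ k, (U (Function.update i k (i k + 1)) - 2 * U i + U (Function.update i k (i k - 1)))
        / hmesh d lvl k ^ 2
      = f (gridpt d lvl i))

/-- `U` is the upwind (implicit Euler) solution of the advection equation
`Σᵢ ∂ᵢu = 0` on the grid of level `lvl`, with inflow data given by `u`. -/
def IsUpwindSol (d : ℕ) (lvl : Fin d → ℕ) (u : (Fin d → ℝ) → ℝ)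
    (U : (Fin d → ℕ) → ℝ) : Prop :=
  (∀ i : Fin d → ℕ, IsGridIdx d lvl i → (∃ k, i k = 0) → U i = u (gridpt d lvl i)) ∧
  (∀ i : Fin d → ℕ, IsGridIdx d lvl i → (∀ k, 1 ≤ i k) →
    ∑ k, (U i - U (Function.update i k (i k - 1))) / hmesh d lvl k = 0)

/-- `g` is the multilinear interpolant of the grid function `U` on the grid of
level `lvl`: it agrees with `U` at all grid points and is a polynomial of degree
at most `1` in each variable on each grid cell. -/
def IsInterp (d : ℕ) (lvl : Fin d → ℕ) (U : (Fin d → ℕ) → ℝ)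
    (g : (Fin d → ℝ) → ℝ) : Prop :=
  (∀ i : Fin d → ℕ, IsGridIdx d lvl i → g (gridpt d lvl i) = U i) ∧
  (∀ j : Fin d → ℕ, (∀ k, j k < 2 ^ lvl k) →
    ∃ c : Finset (Fin d) → ℝ, ∀ x : Fin d → ℝ,
      (∀ k, (j k : ℝ) * hmesh d lvl k ≤ x k ∧ x k ≤ ((j k : ℝ) + 1) * hmesh d lvl k) →
      g x = ∑ T : Finset (Fin d), c T * ∏ k ∈ T, x k)

/-- The domain `{x : x ± h e_k ∈ [0,1]^d}` of the truncation error terms. -/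
def diffDom (d : ℕ) (k : Fin d) (h : ℝ) : Set (Fin d → ℝ) :=
  {x | Function.update x k (x k + h) ∈ unitCube d ∧
       Function.update x k (x k - h) ∈ unitCube d}

namespace PoissonExpansion

open MeasureTheory

variable {d : ℕ}

/-- The product sine function `∏ᵢ sin(π νᵢ xᵢ)`. -/
noncomputable def eigfn (ν : Fin d → ℕ) (x : Fin d → ℝ) : ℝ :=
  ∏ i, Real.sin (Real.pi * ν i * x i)

/-- The eigenvalue of `-δ_h²`, `h = 2^{-l}`, on `sin(π ν x)`. -/
noncomputable def symb (l ν : ℕ) : ℝ :=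
  (2 ^ (l + 1) * Real.sin (Real.pi * ν / 2 ^ (l + 1))) ^ 2

/-- The eigenvalue of the negative Laplacian discretised in the directions of `J`. -/
noncomputable def lam (J : Finset (Fin d)) (lvl ν : Fin d → ℕ) : ℝ :=
  ∑ i, if i ∈ J then symb (lvl i) (ν i) else (Real.pi * ν i) ^ 2

/-- The eigenvalue of the truncation error operator `(δ_h² - ∂²) / h²` on `sin(π ν x)`. -/
noncomputable def trunc (l ν : ℕ) : ℝ :=
  ((Real.pi * ν) ^ 2 - symb l ν) / ((2 : ℝ) ^ l)⁻¹ ^ 2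

lemma abs_eigfn_le_one (ν : Fin d → ℕ) (x : Fin d → ℝ) : |eigfn ν x| ≤ 1 := by
  rw [eigfn, Finset.abs_prod]
  exact Finset.prod_le_one (fun _ _ => abs_nonneg _) fun _ _ => Real.abs_sin_le_one _

lemma continuous_eigfn (ν : Fin d → ℕ) : Continuous (eigfn ν) := by
  unfold eigfn; fun_prop

lemma eigfn_update (ν : Fin d → ℕ) (x : Fin d → ℝ) (k : Fin d) (t : ℝ) :
    eigfn ν (Function.update x k t) =
      Real.sin (Real.pi * ν k * t) * ∏ i ∈ Finset.univ.erase k, Real.sin (Real.pi * ν i * x i) := by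
  rw [eigfn, ← Finset.mul_prod_erase _ _ (Finset.mem_univ k)]
  congr 1
  · simp
  · refine Finset.prod_congr rfl fun i hi => ?_
    rw [Function.update_of_ne (Finset.ne_of_mem_erase hi)]

lemma eigfn_eq_mul (ν : Fin d → ℕ) (x : Fin d → ℝ) (k : Fin d) :
    eigfn ν x =
      Real.sin (Real.pi * ν k * x k) *
        ∏ i ∈ Finset.univ.erase k, Real.sin (Real.pi * ν i * x i) := by
  rw [eigfn, ← Finset.mul_prod_erase _ _ (Finset.mem_univ k)]

lemma eigfn_eq_zero_of_sin {ν : Fin d → ℕ} {x : Fin d → ℝ} (k : Fin d)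
    (h : Real.sin (Real.pi * ν k * x k) = 0) : eigfn ν x = 0 :=
  Finset.prod_eq_zero (Finset.mem_univ k) h

lemma hmesh_pos (lvl : Fin d → ℕ) (k : Fin d) : 0 < hmesh d lvl k := by
  unfold hmesh; positivity

lemma eigfn_add_add_eigfn_sub (ν : Fin d → ℕ) (x : Fin d → ℝ) (k : Fin d) (s : ℝ) :
    eigfn ν (Function.update x k (x k + s)) + eigfn ν (Function.update x k (x k - s)) =
      2 * Real.cos (Real.pi * ν k * s) * eigfn ν x := by
  rw [eigfn_update, eigfn_update, eigfn_eq_mul ν x k, mul_add, mul_sub, Real.sin_add,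
    Real.sin_sub]
  ring

lemma eigfn_second_difference (lvl ν : Fin d → ℕ) (x : Fin d → ℝ) (k : Fin d) :
    (eigfn ν (Function.update x k (x k + hmesh d lvl k)) - 2 * eigfn ν x +
        eigfn ν (Function.update x k (x k - hmesh d lvl k))) / hmesh d lvl k ^ 2 =
      -symb (lvl k) (ν k) * eigfn ν x := by
  have h := eigfn_add_add_eigfn_sub ν x k (hmesh d lvl k)
  have hc : Real.cos (Real.pi * ν k * hmesh d lvl k) =
      1 - 2 * Real.sin (Real.pi * ν k / 2 ^ (lvl k + 1)) ^ 2 := by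
    have : Real.pi * ν k * hmesh d lvl k = 2 * (Real.pi * ν k / 2 ^ (lvl k + 1)) := by
      unfold hmesh; field_simp; ring
    rw [this, Real.cos_two_mul, Real.cos_sq']; ring
  rw [hc] at h
  rw [div_eq_iff (pow_ne_zero _ (hmesh_pos lvl k).ne'), symb]
  have h1 : (2 : ℝ) ^ (lvl k + 1) * hmesh d lvl k = 2 := by
    unfold hmesh; field_simp; ring
  calc _ = -((2 : ℝ) ^ 2 * Real.sin (Real.pi * ν k / 2 ^ (lvl k + 1)) ^ 2 * eigfn ν x) := by
        linarith
    _ = _ := by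
        generalize Real.sin (Real.pi * ν k / 2 ^ (lvl k + 1)) = s
        linear_combination s ^ 2 * eigfn ν x * (2 ^ (lvl k + 1) * hmesh d lvl k + 2) * h1

lemma symb_nonneg (l ν : ℕ) : 0 ≤ symb l ν := sq_nonneg _

lemma symb_le (l ν : ℕ) : symb l ν ≤ (Real.pi * ν) ^ 2 := by
  unfold symb
  have h := Real.sin_sq_le_sq (x := Real.pi * ν / 2 ^ (l + 1))
  calc _ = ((2 : ℝ) ^ (l + 1)) ^ 2 * Real.sin (Real.pi * ν / 2 ^ (l + 1)) ^ 2 := mul_pow _ _ _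
    _ ≤ ((2 : ℝ) ^ (l + 1)) ^ 2 * (Real.pi * ν / 2 ^ (l + 1)) ^ 2 := by gcongr
    _ = _ := by field_simp

lemma two_div_le_sin {N r : ℕ} (h0 : 0 < r) (hr : r < N) :
    2 / (N : ℝ) ≤ Real.sin (Real.pi * r / N) := by
  have hN : (0 : ℝ) < N := by exact_mod_cast h0.trans hr
  have aux : ∀ s : ℝ, 1 ≤ s → s ≤ N / 2 → 2 / (N : ℝ) ≤ Real.sin (Real.pi * s / N) := by
    intro s hs hs'
    have := Real.mul_le_sin (x := Real.pi * s / N) (by positivity)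
      (by rw [div_le_div_iff₀ hN two_pos]; nlinarith [Real.pi_pos])
    refine le_trans ?_ this
    rw [div_le_iff₀ hN]
    field_simp
    exact hs
  by_cases h : (r : ℝ) ≤ N / 2
  · exact aux r (by exact_mod_cast h0) h
  · have h1 : ((N - r : ℕ) : ℝ) = N - r := by push_cast [hr.le]; ring
    have h2 : (1 : ℝ) ≤ N - r := by rw [← h1]; exact_mod_cast Nat.sub_pos_of_lt hr
    have := aux (N - r) h2 (by linarith [not_le.1 h])
    rwa [show Real.pi * (N - r) / N = Real.pi - Real.pi * r / N by field_simp, Real.sin_pi_sub]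
      at this

lemma symb_eq_zero_or_dvd (l ν : ℕ) : 4 ≤ symb l ν ∨ 2 ^ (l + 1) ∣ ν := by
  by_cases h : 2 ^ (l + 1) ∣ ν
  · exact Or.inr h
  left
  set N := 2 ^ (l + 1) with hN
  have hN0 : 0 < N := by positivity
  have hr0 : 0 < ν % N := Nat.pos_of_ne_zero fun h0 => h (Nat.dvd_of_mod_eq_zero h0)
  have hs := two_div_le_sin hr0 (Nat.mod_lt ν hN0)
  have hNR : (0 : ℝ) < N := by exact_mod_cast hN0
  have hcast : ((2 : ℝ) ^ (l + 1)) = N := by rw [hN]; push_cast; rfl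
  have hsq : Real.sin (Real.pi * ν / N) ^ 2 = Real.sin (Real.pi * (ν % N : ℕ) / N) ^ 2 := by
    have : Real.pi * ν / N = Real.pi * (ν % N : ℕ) / N + (ν / N : ℕ) * Real.pi := by
      have : (ν : ℝ) = (ν % N : ℕ) + N * (ν / N : ℕ) := by exact_mod_cast (Nat.mod_add_div ν N).symm
      conv_lhs => rw [this]
      field_simp
    rw [this, Real.sin_add_nat_mul_pi, mul_pow, ← pow_mul, mul_comm _ 2, pow_mul]
    simp
  unfold symb
  rw [hcast, mul_pow, hsq, ← mul_pow]
  have : 2 ≤ N * Real.sin (Real.pi * (ν % N : ℕ) / N) := by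
    have := mul_le_mul_of_nonneg_left hs hNR.le
    rwa [mul_div_cancel₀ _ hNR.ne'] at this
  nlinarith

lemma lam_nonneg (J : Finset (Fin d)) (lvl ν : Fin d → ℕ) : 0 ≤ lam J lvl ν :=
  Finset.sum_nonneg fun i _ => by split_ifs <;> first | exact symb_nonneg _ _ | positivity

lemma lam_anti {I J : Finset (Fin d)} (h : I ⊆ J) (lvl ν : Fin d → ℕ) :
    lam J lvl ν ≤ lam I lvl ν := by
  refine Finset.sum_le_sum fun i _ => ?_
  by_cases hI : i ∈ I
  · simp [hI, h hI]
  · split_ifs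
    · exact symb_le _ _
    · rfl

/-- Either `lam` is bounded below, or every direction is resonant. -/
lemma four_le_lam_or (J : Finset (Fin d)) (lvl ν : Fin d → ℕ) :
    4 ≤ lam J lvl ν ∨
      ∀ i, (i ∈ J → 2 ^ (lvl i + 1) ∣ ν i) ∧ (i ∉ J → ν i = 0) := by
  by_contra! hcon
  obtain ⟨h4, i, hi⟩ := hcon
  have hterm : 4 ≤ if i ∈ J then symb (lvl i) (ν i) else (Real.pi * ν i) ^ 2 := by
    split_ifs with hJ
    · exact (symb_eq_zero_or_dvd (lvl i) (ν i)).resolve_right fun h => (hi fun _ => h).1 hJ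
    · have h0 : ν i ≠ 0 := (hi fun h => (hJ h).elim).2
      have : (1 : ℝ) ≤ ν i := by exact_mod_cast Nat.pos_of_ne_zero h0
      have : 3 ≤ Real.pi * ν i := by nlinarith [Real.pi_gt_three]
      nlinarith
  refine h4.not_ge (hterm.trans ?_)
  exact Finset.single_le_sum (f := fun i => if i ∈ J then symb (lvl i) (ν i) else
    (Real.pi * ν i) ^ 2)
    (fun i _ => by split_ifs <;> first | exact symb_nonneg _ _ | positivity) (Finset.mem_univ i)

lemma inv_lam_nonneg (J : Finset (Fin d)) (lvl ν : Fin d → ℕ) : 0 ≤ (lam J lvl ν)⁻¹ :=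
  inv_nonneg.2 (lam_nonneg _ _ _)

lemma inv_lam_le (J : Finset (Fin d)) (lvl ν : Fin d → ℕ) : (lam J lvl ν)⁻¹ ≤ 1 / 4 := by
  rcases four_le_lam_or J lvl ν with h | h
  · rw [one_div]; exact inv_anti₀ (by norm_num) h
  · have : lam J lvl ν = 0 := by
      refine Finset.sum_eq_zero fun i _ => ?_
      split_ifs with hJ
      · obtain ⟨m, hm⟩ := (h i).1 hJ
        have : Real.pi * (ν i : ℝ) / 2 ^ (lvl i + 1) = m * Real.pi := by
          rw [hm]; push_cast; field_simp
        simp [symb, this, Real.sin_nat_mul_pi]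
      · simp [(h i).2 hJ]
    rw [this]; norm_num

lemma eigfn_eq_zero_of_lam_eq_zero (hd : 0 < d) {J : Finset (Fin d)} {lvl ν : Fin d → ℕ}
    (h : lam J lvl ν = 0) {x : Fin d → ℝ} (hx : x ∈ Iplane d J lvl) : eigfn ν x = 0 := by
  have h' := (four_le_lam_or J lvl ν).resolve_left (by rw [h]; norm_num)
  let i : Fin d := ⟨0, hd⟩
  apply eigfn_eq_zero_of_sin i
  by_cases hJ : i ∈ J
  · obtain ⟨m, hm⟩ := (h' i).1 hJ
    obtain ⟨p, hp⟩ := hx.2 i hJ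
    have : Real.pi * (ν i : ℝ) * x i = ((2 * m * p : ℤ) : ℝ) * Real.pi := by
      rw [hm, hp, hmesh]; push_cast; field_simp; ring
    rw [this, Real.sin_int_mul_pi]
  · simp [(h' i).2 hJ]

lemma gridpt_mem_unitCube {lvl i : Fin d → ℕ} (hi : IsGridIdx d lvl i) :
    gridpt d lvl i ∈ unitCube d := by
  refine ⟨fun k => ?_, fun k => ?_⟩
  · exact mul_nonneg (Nat.cast_nonneg _) (hmesh_pos lvl k).le
  · have : (i k : ℝ) ≤ 2 ^ lvl k := by exact_mod_cast hi k
    simp only [gridpt, hmesh, Pi.one_apply]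
    rw [← div_eq_mul_inv, div_le_one (by positivity)]
    exact this

lemma gridpt_mem_Iplane {lvl i : Fin d → ℕ} (hi : IsGridIdx d lvl i) (J : Finset (Fin d)) :
    gridpt d lvl i ∈ Iplane d J lvl :=
  ⟨gridpt_mem_unitCube hi, fun j _ => ⟨i j, by simp [gridpt]⟩⟩

lemma gridpt_update (lvl i : Fin d → ℕ) (k : Fin d) (n : ℕ) :
    gridpt d lvl (Function.update i k n) =
      Function.update (gridpt d lvl i) k (n * hmesh d lvl k) := by
  ext j
  by_cases h : j = k
  · subst h; simp [gridpt]
  · simp [gridpt, Function.update_of_ne h]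

/-- The discrete Laplacian on the grid of level `lvl`. -/
noncomputable def discLap (lvl : Fin d → ℕ) (U : (Fin d → ℕ) → ℝ) (i : Fin d → ℕ) : ℝ :=
  ∑ k, (U (Function.update i k (i k + 1)) - 2 * U i + U (Function.update i k (i k - 1)))
        / hmesh d lvl k ^ 2

lemma discLap_sub (lvl : Fin d → ℕ) (U V : (Fin d → ℕ) → ℝ) (i : Fin d → ℕ) :
    discLap lvl (fun i => U i - V i) i = discLap lvl U i - discLap lvl V i := by
  simp only [discLap, ← Finset.sum_sub_distrib]
  exact Finset.sum_congr rfl fun k _ => by ring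

lemma discLap_const_mul (lvl : Fin d → ℕ) (c : ℝ) (U : (Fin d → ℕ) → ℝ) (i : Fin d → ℕ) :
    discLap lvl (fun i => c * U i) i = c * discLap lvl U i := by
  simp only [discLap, Finset.mul_sum]
  exact Finset.sum_congr rfl fun k _ => by ring

/-- Weak discrete maximum principle. -/
lemma discLap_max_principle (lvl : Fin d → ℕ) {U : (Fin d → ℕ) → ℝ}
    (hb : ∀ i, IsGridIdx d lvl i → (∃ k, i k = 0 ∨ i k = 2 ^ lvl k) → U i ≤ 0)
    (hL : ∀ i, (∀ k, 1 ≤ i k ∧ i k < 2 ^ lvl k) → 0 < discLap lvl U i) :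
    ∀ i, IsGridIdx d lvl i → U i ≤ 0 := by
  have hfin : (Finset.Iic (fun k => 2 ^ lvl k : Fin d → ℕ)).Nonempty := ⟨0, by simp⟩
  obtain ⟨m, hm, hmax⟩ := Finset.exists_max_image _ U hfin
  have hmem : ∀ i, i ∈ Finset.Iic (fun k => 2 ^ lvl k : Fin d → ℕ) ↔ IsGridIdx d lvl i := by
    intro i; simp [IsGridIdx, Pi.le_def]
  have hm' := (hmem m).1 hm
  intro i hi
  refine (hmax i ((hmem i).2 hi)).trans ?_
  by_cases hbd : ∃ k, m k = 0 ∨ m k = 2 ^ lvl k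
  · exact hb m hm' hbd
  · push Not at hbd
    have hInt : ∀ k, 1 ≤ m k ∧ m k < 2 ^ lvl k := fun k =>
      ⟨Nat.pos_of_ne_zero (hbd k).1, lt_of_le_of_ne (hm' k) (hbd k).2⟩
    have hpos := hL m hInt
    have hup : ∀ k n, n ≤ 2 ^ lvl k → U (Function.update m k n) ≤ U m := by
      intro k n hn
      refine hmax _ ((hmem _).2 fun j => ?_)
      by_cases h : j = k
      · subst h; simpa using hn
      · simpa [Function.update_of_ne h] using hm' j
    refine absurd hpos (not_lt.2 (Finset.sum_nonpos fun k _ => ?_))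
    refine div_nonpos_of_nonpos_of_nonneg ?_ (sq_nonneg _)
    have h1 := hup k (m k + 1) (hInt k).2
    have h2 := hup k (m k - 1) ((Nat.sub_le _ _).trans (hm' k))
    linarith

/-- The discrete Green operator has norm at most `1/8`, by comparison with the barrier
`x₁ (1 - x₁) / 2`. -/
lemma le_of_discLap_ge (lvl : Fin d → ℕ) (hd : 0 < d) {U : (Fin d → ℕ) → ℝ} {M : ℝ}
    (hM : 0 ≤ M)
    (hb : ∀ i, IsGridIdx d lvl i → (∃ k, i k = 0 ∨ i k = 2 ^ lvl k) → U i ≤ 0)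
    (hL : ∀ i, (∀ k, 1 ≤ i k ∧ i k < 2 ^ lvl k) → -M ≤ discLap lvl U i) :
    ∀ i, IsGridIdx d lvl i → U i ≤ M / 8 := by
  intro i hi
  let e : Fin d := ⟨0, hd⟩
  let b : (Fin d → ℕ) → ℝ := fun i => gridpt d lvl i e * (1 - gridpt d lvl i e) / 2
  have hb0 : ∀ i, IsGridIdx d lvl i → 0 ≤ b i := by
    intro i hi
    have h := gridpt_mem_unitCube hi
    have h0 := h.1 e
    have h1 := h.2 e
    simp only [Pi.zero_apply, Pi.one_apply] at h0 h1
    have := mul_nonneg h0 (sub_nonneg.2 h1)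
    simp only [b]; linarith
  have hbL : ∀ i, (∀ k, 1 ≤ i k ∧ i k < 2 ^ lvl k) → discLap lvl b i = -1 := by
    intro i hi
    rw [discLap, Finset.sum_eq_single e]
    · simp only [b, gridpt_update, Function.update_self]
      have := (hmesh_pos lvl e).ne'
      rw [Nat.cast_sub (hi e).1]
      simp only [gridpt]
      push_cast
      field_simp
      ring
    · intro k _ hk
      simp only [b, gridpt_update, Function.update_of_ne hk.symm]
      ring
    · simp
  have key : ∀ ε > 0, U i ≤ (M + ε) / 8 := by
    intro ε hε
    have := discLap_max_principle lvl (U := fun i => U i - (M + ε) * b i)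
      (fun i hi hbd => by
        have := mul_nonneg (add_pos_of_nonneg_of_pos hM hε).le (hb0 i hi)
        linarith [hb i hi hbd])
      (fun i hi => by
        rw [discLap_sub lvl U (fun i => (M + ε) * b i), discLap_const_mul, hbL i hi]
        linarith [hL i hi]) i hi
    have hb8 : b i ≤ 1 / 8 := by
      simp only [b]; nlinarith [sq_nonneg (gridpt d lvl i e - 1 / 2)]
    nlinarith
  refine le_of_forall_pos_le_add fun ε hε => ?_
  have := key (8 * ε) (by positivity)
  linarith

lemma abs_le_of_abs_discLap_le (lvl : Fin d → ℕ) (hd : 0 < d) {U : (Fin d → ℕ) → ℝ} {M : ℝ}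
    (hM : 0 ≤ M)
    (hb : ∀ i, IsGridIdx d lvl i → (∃ k, i k = 0 ∨ i k = 2 ^ lvl k) → U i = 0)
    (hL : ∀ i, (∀ k, 1 ≤ i k ∧ i k < 2 ^ lvl k) → |discLap lvl U i| ≤ M) :
    ∀ i, IsGridIdx d lvl i → |U i| ≤ M / 8 := by
  intro i hi
  refine abs_le.2 ⟨?_, le_of_discLap_ge lvl hd hM (fun i hi h => (hb i hi h).le)
    (fun i hi => (abs_le.1 (hL i hi)).1) i hi⟩
  have := le_of_discLap_ge lvl hd (U := fun i => -1 * U i) hM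
    (fun i hi h => by simp [hb i hi h])
    (fun i hi => by rw [discLap_const_mul]; linarith [(abs_le.1 (hL i hi)).2]) i hi
  linarith

lemma eigfn_gridpt_boundary {lvl ν i : Fin d → ℕ} (h : ∃ k, i k = 0 ∨ i k = 2 ^ lvl k) :
    eigfn ν (gridpt d lvl i) = 0 := by
  obtain ⟨k, hk⟩ := h
  apply eigfn_eq_zero_of_sin k
  rcases hk with hk | hk
  · simp [gridpt, hk]
  · have : (gridpt d lvl i) k = 1 := by simp [gridpt, hk, hmesh]
    rw [this, mul_one, mul_comm, Real.sin_nat_mul_pi]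

lemma summable_mul_eigfn {a : (Fin d → ℕ) → ℝ} (ha : Summable a) (x : Fin d → ℝ) :
    Summable fun ν => a ν * eigfn ν x := by
  refine Summable.of_norm_bounded ha.abs fun ν => ?_
  rw [Real.norm_eq_abs, abs_mul]
  exact mul_le_of_le_one_right (abs_nonneg _) (abs_eigfn_le_one ν x)

lemma continuous_sineSeries {a : (Fin d → ℕ) → ℝ} (ha : Summable a) :
    Continuous fun x => ∑' ν, a ν * eigfn ν x := by
  refine continuous_tsum (fun ν => continuous_const.mul (continuous_eigfn ν)) ha.abs
    fun ν x => ?_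
  rw [Real.norm_eq_abs, abs_mul]
  exact mul_le_of_le_one_right (abs_nonneg _) (abs_eigfn_le_one ν x)

/-- The discrete Laplacian acts diagonally on sine series. -/
lemma discLap_sineSeries {a : (Fin d → ℕ) → ℝ} (ha : Summable a) (lvl i : Fin d → ℕ)
    (hi : ∀ k, 1 ≤ i k) :
    discLap lvl (fun i => ∑' ν, a ν * eigfn ν (gridpt d lvl i)) i =
      -∑' ν, a ν * lam Finset.univ lvl ν * eigfn ν (gridpt d lvl i) := by
  have hs := fun x => (summable_mul_eigfn ha x).hasSum
  rw [← tsum_neg]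
  refine (HasSum.tsum_eq ?_).symm
  have : ∀ ν, -(a ν * lam Finset.univ lvl ν * eigfn ν (gridpt d lvl i)) =
      ∑ k, (a ν * eigfn ν (gridpt d lvl (Function.update i k (i k + 1))) -
        2 * (a ν * eigfn ν (gridpt d lvl i)) +
        a ν * eigfn ν (gridpt d lvl (Function.update i k (i k - 1)))) / hmesh d lvl k ^ 2 := by
    intro ν
    have hk : ∀ k, (a ν * eigfn ν (gridpt d lvl (Function.update i k (i k + 1))) -
        2 * (a ν * eigfn ν (gridpt d lvl i)) +
        a ν * eigfn ν (gridpt d lvl (Function.update i k (i k - 1)))) / hmesh d lvl k ^ 2 =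
        -(a ν * eigfn ν (gridpt d lvl i)) * symb (lvl k) (ν k) := by
      intro k
      have := eigfn_second_difference lvl ν (gridpt d lvl i) k
      rw [gridpt_update, gridpt_update, Nat.cast_sub (hi k)]
      have e1 : ((i k + 1 : ℕ) : ℝ) * hmesh d lvl k = gridpt d lvl i k + hmesh d lvl k := by
        simp only [gridpt]; push_cast; ring
      have e2 : ((i k : ℝ) - (1 : ℕ)) * hmesh d lvl k = gridpt d lvl i k - hmesh d lvl k := by
        simp only [gridpt]; push_cast; ring
      rw [e1, e2]
      linear_combination a ν * this
    rw [Finset.sum_congr rfl fun k _ => hk k, ← Finset.mul_sum]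
    simp only [lam, Finset.mem_univ, if_true]
    ring
  simp_rw [this]
  exact hasSum_sum fun k _ => (((hs _).sub ((hs _).mul_left 2)).add (hs _)).div_const _

lemma tendsto_symb (ν : ℕ) :
    Filter.Tendsto (fun N => symb N ν) Filter.atTop (nhds ((Real.pi * ν) ^ 2)) := by
  have h1 : HasDerivAt (fun t : ℝ => Real.sin (Real.pi * ν * t)) (Real.pi * ν) 0 := by
    have := ((hasDerivAt_id (0 : ℝ)).const_mul (Real.pi * ν)).sin
    simpa using this
  have h2 := hasDerivAt_iff_tendsto_slope_zero.1 h1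
  have h3 : Filter.Tendsto (fun N : ℕ => ((1 / 2 : ℝ)) ^ (N + 1)) Filter.atTop
      (nhdsWithin 0 {0}ᶜ) := by
    refine tendsto_nhdsWithin_iff.2 ⟨?_, Filter.Eventually.of_forall fun N => ?_⟩
    · exact (tendsto_pow_atTop_nhds_zero_of_lt_one (by norm_num) (by norm_num)).comp
        (Filter.tendsto_add_atTop_nat 1)
    · simp
  refine ((h2.comp h3).pow 2).congr fun N => ?_
  simp only [Function.comp_apply, symb, smul_eq_mul, zero_add, mul_zero, Real.sin_zero, sub_zero,
    inv_pow, inv_inv, div_eq_mul_inv, one_mul]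

lemma summable_div_lam {g : (Fin d → ℕ) → ℝ} (hg : Summable g) (J : Finset (Fin d))
    (lvl : Fin d → ℕ) : Summable fun ν => g ν / lam J lvl ν := by
  refine Summable.of_norm_bounded (hg.abs.mul_right (1 / 4)) fun ν => ?_
  rw [Real.norm_eq_abs, div_eq_mul_inv, abs_mul, abs_of_nonneg (inv_lam_nonneg J lvl ν)]
  exact mul_le_mul_of_nonneg_left (inv_lam_le J lvl ν) (abs_nonneg _)

/-- The semi-discrete Green operator has norm at most `1/8`: it is a limit of fully discrete
ones. -/
lemma abs_solve_le (hd : 0 < d) {g : (Fin d → ℕ) → ℝ} (hg : Summable g) (J : Finset (Fin d))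
    (lvl : Fin d → ℕ) {M : ℝ}
    (hM : ∀ x ∈ Iplane d J lvl, |∑' ν, g ν * eigfn ν x| ≤ M) :
    ∀ x ∈ Iplane d J lvl, |∑' ν, g ν / lam J lvl ν * eigfn ν x| ≤ M / 8 := by
  intro x hx
  have hM0 : 0 ≤ M := (abs_nonneg _).trans (hM x hx)
  let lv : ℕ → Fin d → ℕ := fun N i => if i ∈ J then lvl i else N
  let idx : ℕ → Fin d → ℕ := fun N i => ⌊x i * 2 ^ lv N i⌋₊
  have hmesh_eq : ∀ N j, j ∈ J → hmesh d (lv N) j = hmesh d lvl j := by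
    intro N j hj; simp [hmesh, lv, hj]
  have hplane : ∀ N i, IsGridIdx d (lv N) i → gridpt d (lv N) i ∈ Iplane d J lvl := by
    intro N i hi
    exact ⟨gridpt_mem_unitCube hi, fun j hj => ⟨i j, by simp [gridpt, hmesh_eq N j hj]⟩⟩
  have hx0 : ∀ i, 0 ≤ x i := hx.1.1
  have hx1 : ∀ i, x i ≤ 1 := hx.1.2
  have hidx : ∀ N, IsGridIdx d (lv N) (idx N) := by
    intro N i
    have : x i * 2 ^ lv N i ≤ ((2 ^ lv N i : ℕ) : ℝ) := by
      push_cast; exact mul_le_of_le_one_left (by positivity) (hx1 i)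
    exact Nat.floor_le_of_le this
  have hbound : ∀ N, |∑' ν, g ν / lam Finset.univ (lv N) ν *
      eigfn ν (gridpt d (lv N) (idx N))| ≤ M / 8 := by
    intro N
    refine abs_le_of_abs_discLap_le (lv N) hd hM0
      (U := fun i => ∑' ν, g ν / lam Finset.univ (lv N) ν * eigfn ν (gridpt d (lv N) i))
      (fun i _ hbd => by simp [eigfn_gridpt_boundary hbd]) (fun i hi => ?_) _ (hidx N)
    have hgi : IsGridIdx d (lv N) i := fun k => (hi k).2.le
    rw [discLap_sineSeries (summable_div_lam hg _ _) _ _ (fun k => (hi k).1), abs_neg]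
    convert hM _ (hplane N i hgi) using 4 with ν
    by_cases h0 : lam Finset.univ (lv N) ν = 0
    · simp [eigfn_eq_zero_of_lam_eq_zero hd h0 (gridpt_mem_Iplane hgi _)]
    · rw [div_mul_cancel₀ _ h0]
  have hpt : Filter.Tendsto (fun N => gridpt d (lv N) (idx N)) Filter.atTop (nhds x) := by
    refine tendsto_pi_nhds.2 fun i => ?_
    by_cases hi : i ∈ J
    · obtain ⟨m, hm⟩ := hx.2 i hi
      refine tendsto_const_nhds.congr fun N => ?_
      have hxm : x i * 2 ^ lv N i = m := by
        rw [hm]; simp [lv, hi, hmesh]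
      have hm0 : 0 ≤ m := by
        have : (0 : ℝ) ≤ m := by rw [← hxm]; exact mul_nonneg (hx0 i) (by positivity)
        exact_mod_cast this
      simp only [gridpt, idx, hxm, hmesh_eq N i hi]
      rw [hm]
      lift m to ℕ using hm0
      simp
    · have h2 : Filter.Tendsto (fun N : ℕ => (2 : ℝ) ^ N) Filter.atTop Filter.atTop :=
        tendsto_pow_atTop_atTop_of_one_lt one_lt_two
      have := (tendsto_nat_floor_mul_div_atTop (hx0 i)).comp h2
      refine this.congr fun N => ?_
      simp [gridpt, idx, lv, hi, hmesh, div_eq_mul_inv]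
  have hlim : Filter.Tendsto (fun N => ∑' ν, g ν / lam Finset.univ (lv N) ν *
      eigfn ν (gridpt d (lv N) (idx N))) Filter.atTop
      (nhds (∑' ν, g ν / lam J lvl ν * eigfn ν x)) := by
    refine tendsto_tsum_of_dominated_convergence hg.abs (fun ν => ?_)
      (Filter.Eventually.of_forall fun N ν => ?_)
    · by_cases h0 : lam J lvl ν = 0
      · simp [h0, fun N => eigfn_eq_zero_of_lam_eq_zero hd h0 (hplane N _ (hidx N))]
      · refine Filter.Tendsto.mul (Filter.Tendsto.div tendsto_const_nhds ?_ h0)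
          (((continuous_eigfn ν).tendsto x).comp hpt)
        refine tendsto_finsetSum _ fun i _ => ?_
        by_cases hi : i ∈ J
        · simp [lv, hi]
        · simpa [lv, hi] using tendsto_symb (ν i)
    · rw [Real.norm_eq_abs, abs_mul, div_eq_mul_inv, abs_mul,
        abs_of_nonneg (inv_lam_nonneg _ _ _), mul_assoc]
      refine mul_le_of_le_one_right (abs_nonneg _) ?_
      exact mul_le_one₀ ((inv_lam_le _ _ _).trans (by norm_num)) (abs_nonneg _)
        (abs_eigfn_le_one _ _)
  exact le_of_tendsto hlim.abs (Filter.Eventually.of_forall hbound)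

/-- The multiplier sending the solution to the error coefficient of `∏_{j ∈ J} h_j²`. -/
noncomputable def errCoef (lvl ν : Fin d → ℕ) (J : Finset (Fin d)) : ℝ :=
  if J = ∅ then 1
  else (∑ j : J, trunc (lvl j) (ν j) * errCoef lvl ν (J.erase j)) / lam J lvl ν
termination_by J.card
decreasing_by exact Finset.card_erase_lt_of_mem j.2

lemma errCoef_empty (lvl ν : Fin d → ℕ) : errCoef lvl ν ∅ = 1 := by
  rw [errCoef]; simp

lemma errCoef_of_nonempty (lvl ν : Fin d → ℕ) {J : Finset (Fin d)} (hJ : J.Nonempty) :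
    errCoef lvl ν J =
      (∑ j ∈ J, trunc (lvl j) (ν j) * errCoef lvl ν (J.erase j)) / lam J lvl ν := by
  rw [errCoef, if_neg hJ.ne_empty,
    Finset.sum_coe_sort J fun j => trunc (lvl j) (ν j) * errCoef lvl ν (J.erase j)]

lemma lam_congr {J : Finset (Fin d)} {lvl lvl' : Fin d → ℕ} (h : ∀ j ∈ J, lvl j = lvl' j)
    (ν : Fin d → ℕ) : lam J lvl ν = lam J lvl' ν := by
  refine Finset.sum_congr rfl fun i _ => ?_
  split_ifs with hi
  · rw [h i hi]
  · rfl

lemma errCoef_congr (ν : Fin d → ℕ) (J : Finset (Fin d)) :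
    ∀ {lvl lvl' : Fin d → ℕ}, (∀ j ∈ J, lvl j = lvl' j) →
      errCoef lvl ν J = errCoef lvl' ν J := by
  induction J using Finset.strongInduction with
  | H J ih =>
    intro lvl lvl' h
    rcases J.eq_empty_or_nonempty with rfl | hJ
    · simp [errCoef_empty]
    · rw [errCoef_of_nonempty _ _ hJ, errCoef_of_nonempty _ _ hJ, lam_congr h]
      congr 1
      refine Finset.sum_congr rfl fun j hj => ?_
      rw [h j hj, ih _ (Finset.erase_ssubset hj) fun i hi => h i (Finset.mem_of_mem_erase hi)]

/-- The recursion for `errCoef` inverts the fully discrete symbol. -/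
lemma lam_univ_mul_sum_errCoef {lvl ν : Fin d → ℕ} (h0 : lam Finset.univ lvl ν ≠ 0) :
    lam Finset.univ lvl ν * ∑ J : Finset (Fin d), (∏ j ∈ J, hmesh d lvl j ^ 2) * errCoef lvl ν J =
      ∑ i, (Real.pi * ν i) ^ 2 := by
  have hJ0 : ∀ J, lam J lvl ν ≠ 0 := fun J =>
    (((lam_nonneg _ _ _).lt_of_ne' h0).trans_le (lam_anti (Finset.subset_univ J) _ _)).ne'
  have hτ : ∀ i, hmesh d lvl i ^ 2 * trunc (lvl i) (ν i) =
      (Real.pi * ν i) ^ 2 - symb (lvl i) (ν i) := by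
    intro i
    have := (hmesh_pos lvl i).ne'
    unfold trunc; change _ * (_ / hmesh d lvl i ^ 2) = _
    field_simp
  have hlam : ∀ J, lam Finset.univ lvl ν =
      lam J lvl ν - ∑ i ∈ Jᶜ, hmesh d lvl i ^ 2 * trunc (lvl i) (ν i) := by
    intro J
    rw [eq_sub_iff_add_eq, lam, lam, ← Finset.sum_add_sum_compl J,
      ← Finset.sum_add_sum_compl J (fun i => if i ∈ J then _ else _), add_assoc,
      ← Finset.sum_add_distrib]
    congr 1
    · exact Finset.sum_congr rfl fun i hi => by simp [hi]
    · refine Finset.sum_congr rfl fun i hi => ?_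
      rw [if_neg (Finset.mem_compl.1 hi), hτ]; simp
  have hstep : ∀ J, (∏ j ∈ J, hmesh d lvl j ^ 2) * (lam J lvl ν * errCoef lvl ν J) =
      (if J = ∅ then lam ∅ lvl ν else 0) + ∑ j ∈ J, (∏ i ∈ J, hmesh d lvl i ^ 2) *
        (trunc (lvl j) (ν j) * errCoef lvl ν (J.erase j)) := by
    intro J
    rcases J.eq_empty_or_nonempty with rfl | hJ
    · simp [errCoef_empty]
    · rw [errCoef_of_nonempty _ _ hJ, mul_div_cancel₀ _ (hJ0 J), if_neg hJ.ne_empty, zero_add,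
        Finset.mul_sum]
  have hreindex : ∑ J : Finset (Fin d), ∑ j ∈ J, (∏ i ∈ J, hmesh d lvl i ^ 2) *
        (trunc (lvl j) (ν j) * errCoef lvl ν (J.erase j)) =
      ∑ J : Finset (Fin d), ∑ i ∈ Jᶜ, hmesh d lvl i ^ 2 * trunc (lvl i) (ν i) *
        ((∏ j ∈ J, hmesh d lvl j ^ 2) * errCoef lvl ν J) := by
    rw [Finset.sum_sigma', Finset.sum_sigma']
    refine Finset.sum_bij' (fun p _ => ⟨p.1.erase p.2, p.2⟩) (fun p _ => ⟨insert p.2 p.1, p.2⟩)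
      ?_ ?_ ?_ ?_ ?_
    · simp
    · simp
    · rintro ⟨J, j⟩ hp
      have hj : j ∈ J := by simpa using hp
      simp [Finset.insert_erase hj]
    · rintro ⟨J, j⟩ hp
      have hj : j ∉ J := by simpa using hp
      simp [Finset.erase_insert hj]
    · rintro ⟨J, j⟩ hp
      have hj : j ∈ J := by simpa using hp
      simp only
      rw [← Finset.mul_prod_erase J (fun i => hmesh d lvl i ^ 2) hj]
      ring
  rw [Finset.mul_sum]
  have : ∀ J, lam Finset.univ lvl ν * ((∏ j ∈ J, hmesh d lvl j ^ 2) * errCoef lvl ν J) =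
      (∏ j ∈ J, hmesh d lvl j ^ 2) * (lam J lvl ν * errCoef lvl ν J) -
      ∑ i ∈ Jᶜ, hmesh d lvl i ^ 2 * trunc (lvl i) (ν i) *
        ((∏ j ∈ J, hmesh d lvl j ^ 2) * errCoef lvl ν J) := by
    intro J
    conv_lhs => rw [hlam J]
    rw [sub_mul, Finset.sum_mul]; ring
  simp_rw [this]
  rw [Finset.sum_sub_distrib, ← hreindex, Finset.sum_congr rfl fun J _ => hstep J,
    Finset.sum_add_distrib, add_sub_cancel_right]
  simp [lam]

lemma exists_abs_trunc_le (l : ℕ) : ∃ C : ℝ, 0 ≤ C ∧ ∀ ν : ℕ, |trunc l ν| ≤ C * (1 + (ν : ℝ) ^ 2) := by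
  refine ⟨Real.pi ^ 2 / ((2 : ℝ) ^ l)⁻¹ ^ 2, by positivity, fun ν => ?_⟩
  rw [trunc, abs_div, abs_of_nonneg (sub_nonneg.2 (symb_le l ν)), abs_of_nonneg (by positivity),
    div_mul_eq_mul_div]
  gcongr
  nlinarith [symb_nonneg l ν, sq_nonneg Real.pi]

lemma exists_abs_prod_trunc_le (lvl : Fin d → ℕ) (S : Finset (Fin d)) :
    ∃ C : ℝ, 0 ≤ C ∧ ∀ ν : Fin d → ℕ,
      |∏ s ∈ S, trunc (lvl s) (ν s)| ≤ C * ∏ s ∈ S, (1 + (ν s : ℝ) ^ 2) := by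
  choose C hC0 hC using exists_abs_trunc_le
  refine ⟨∏ s ∈ S, C (lvl s), Finset.prod_nonneg fun _ _ => hC0 _, fun ν => ?_⟩
  rw [Finset.abs_prod, ← Finset.prod_mul_distrib]
  exact Finset.prod_le_prod (fun _ _ => abs_nonneg _) fun s _ => hC _ _

lemma exists_abs_errCoef_le (lvl : Fin d → ℕ) (J : Finset (Fin d)) :
    ∃ C : ℝ, 0 ≤ C ∧ ∀ ν : Fin d → ℕ,
      |errCoef lvl ν J| ≤ C * ∏ s ∈ J, (1 + (ν s : ℝ) ^ 2) := by
  induction J using Finset.strongInduction with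
  | H J ih =>
    rcases J.eq_empty_or_nonempty with rfl | hJ
    · exact ⟨1, zero_le_one, fun ν => by simp [errCoef_empty]⟩
    · choose! C hC0 hC using fun j (hj : j ∈ J) => ih _ (Finset.erase_ssubset hj)
      choose T hT0 hT using exists_abs_trunc_le
      refine ⟨∑ j ∈ J, T (lvl j) * C j,
        Finset.sum_nonneg fun j hj => mul_nonneg (hT0 _) (hC0 j hj), fun ν => ?_⟩
      rw [errCoef_of_nonempty _ _ hJ, div_eq_mul_inv, abs_mul,
        abs_of_nonneg (inv_lam_nonneg J lvl ν), Finset.sum_mul]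
      refine (mul_le_of_le_one_right (abs_nonneg _)
        ((inv_lam_le J lvl ν).trans (by norm_num))).trans ?_
      refine (Finset.abs_sum_le_sum_abs _ _).trans (Finset.sum_le_sum fun j hj => ?_)
      rw [abs_mul, ← Finset.mul_prod_erase _ _ hj]
      calc _ ≤ T (lvl j) * (1 + (ν j : ℝ) ^ 2) *
            (C j * ∏ s ∈ J.erase j, (1 + (ν s : ℝ) ^ 2)) :=
            mul_le_mul (hT _ _) (hC j hj ν) (abs_nonneg _)
              (mul_nonneg (hT0 _) (by positivity))
        _ = _ := by ring

lemma summable_errCoef {c : (Fin d → ℕ) → ℝ}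
    (hc : Summable fun ν => |c ν| * ∏ i, (1 + (ν i : ℝ) ^ 2)) (lvl : Fin d → ℕ)
    {J S : Finset (Fin d)} (hJS : Disjoint J S) :
    Summable fun ν => c ν * errCoef lvl ν J * ∏ s ∈ S, trunc (lvl s) (ν s) := by
  obtain ⟨A, hA0, hA⟩ := exists_abs_errCoef_le lvl J
  obtain ⟨B, hB0, hB⟩ := exists_abs_prod_trunc_le lvl S
  refine Summable.of_norm_bounded (hc.mul_left (A * B)) fun ν => ?_
  rw [Real.norm_eq_abs, abs_mul, abs_mul]
  have h1 : (∏ s ∈ J, (1 + (ν s : ℝ) ^ 2)) * ∏ s ∈ S, (1 + (ν s : ℝ) ^ 2) ≤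
      ∏ i, (1 + (ν i : ℝ) ^ 2) := by
    rw [← Finset.prod_union hJS]
    exact Finset.prod_le_prod_of_subset_of_one_le (Finset.subset_univ _)
      (fun _ _ => by positivity) fun i _ _ => by nlinarith [sq_nonneg (ν i : ℝ)]
  calc _ ≤ |c ν| * (A * ∏ s ∈ J, (1 + (ν s : ℝ) ^ 2)) * (B * ∏ s ∈ S, (1 + (ν s : ℝ) ^ 2)) := by
        gcongr
        · exact hA ν
        · exact hB ν
    _ = A * B * (|c ν| * ((∏ s ∈ J, (1 + (ν s : ℝ) ^ 2)) * ∏ s ∈ S, (1 + (ν s : ℝ) ^ 2))) := by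
        ring
    _ ≤ _ := by gcongr

lemma Iplane_anti {I J : Finset (Fin d)} (h : I ⊆ J) (lvl : Fin d → ℕ) :
    Iplane d J lvl ⊆ Iplane d I lvl := fun _ hx => ⟨hx.1, fun j hj => hx.2 j (h hj)⟩

lemma abs_errSeries_le (hd : 0 < d) {c : (Fin d → ℕ) → ℝ} {K : ℝ}
    (hc : Summable fun ν => |c ν| * ∏ i, (1 + (ν i : ℝ) ^ 2))
    (hτ : ∀ (S : Finset (Fin d)) (lvl : Fin d → ℕ) (x : Fin d → ℝ),
      |∑' ν, c ν * (∏ s ∈ S, trunc (lvl s) (ν s)) * eigfn ν x| ≤ K / 12 ^ S.card)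
    (lvl : Fin d → ℕ) (J : Finset (Fin d)) :
    ∀ S, Disjoint J S → ∀ x ∈ Iplane d J lvl,
      |∑' ν, c ν * errCoef lvl ν J * (∏ s ∈ S, trunc (lvl s) (ν s)) * eigfn ν x| ≤
        K * J.card.factorial / (96 ^ J.card * 12 ^ S.card) := by
  induction J using Finset.strongInduction with
  | H J ih =>
    intro S hJS
    rcases J.eq_empty_or_nonempty with rfl | hJ
    · intro x _
      simpa [errCoef_empty] using hτ S lvl x
    have hdisj : ∀ j ∈ J, Disjoint (J.erase j) (insert j S) := by
      intro j hj
      rw [Finset.disjoint_insert_right]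
      exact ⟨Finset.notMem_erase j J, hJS.mono_left (Finset.erase_subset j J)⟩
    have hsum := fun j hj => summable_errCoef hc lvl (hdisj j hj)
    let g : (Fin d → ℕ) → ℝ := fun ν => ∑ j ∈ J, c ν * errCoef lvl ν (J.erase j) *
      ∏ s ∈ insert j S, trunc (lvl s) (ν s)
    have hg : Summable g := summable_sum hsum
    have key := abs_solve_le hd hg J lvl
      (M := K * J.card.factorial / (96 ^ (J.card - 1) * 12 ^ (S.card + 1))) ?_
    · intro x hx
      have h1 : ∀ ν, c ν * errCoef lvl ν J * (∏ s ∈ S, trunc (lvl s) (ν s)) * eigfn ν x =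
          g ν / lam J lvl ν * eigfn ν x := by
        intro ν
        congr 1
        rw [errCoef_of_nonempty _ _ hJ, mul_div_assoc', div_mul_eq_mul_div, Finset.mul_sum,
          Finset.sum_mul]
        congr 1
        refine Finset.sum_congr rfl fun j hj => ?_
        rw [Finset.prod_insert (Finset.disjoint_left.1 hJS hj)]
        ring
      simp_rw [h1]
      refine (key x hx).trans (le_of_eq ?_)
      obtain ⟨m, hm⟩ := Nat.exists_eq_succ_of_ne_zero hJ.card_pos.ne'
      rw [hm, Nat.succ_eq_add_one, Nat.add_sub_cancel, pow_succ, pow_succ]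
      field_simp
      ring
    · intro x hx
      have h2 : ∑' ν, g ν * eigfn ν x = ∑ j ∈ J, ∑' ν, c ν * errCoef lvl ν (J.erase j) *
          (∏ s ∈ insert j S, trunc (lvl s) (ν s)) * eigfn ν x := by
        rw [← Summable.tsum_finsetSum fun j hj => summable_mul_eigfn (hsum j hj) x]
        simp only [g, Finset.sum_mul]
      rw [h2]
      refine (Finset.abs_sum_le_sum_abs _ _).trans ?_
      refine (Finset.sum_le_sum fun j hj => ih _ (Finset.erase_ssubset hj) _ (hdisj j hj) x
        (Iplane_anti (Finset.erase_subset j J) lvl hx)).trans (le_of_eq ?_)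
      rw [Finset.sum_congr rfl (g := fun _ => K * ((J.card - 1).factorial : ℝ) /
        (96 ^ (J.card - 1) * 12 ^ (S.card + 1))) fun j hj => by
          rw [Finset.card_erase_of_mem hj,
            Finset.card_insert_of_notMem (Finset.disjoint_left.1 hJS hj)]]
      rw [Finset.sum_const, nsmul_eq_mul, ← Nat.mul_factorial_pred hJ.card_pos.ne']
      push_cast
      ring

/-- The error expansion, for a solution given by a sine series. -/
theorem expansion_of_sineSeries (hd : 0 < d) {c : (Fin d → ℕ) → ℝ} {K : ℝ}
    {f u : (Fin d → ℝ) → ℝ}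
    (hc : Summable fun ν => |c ν| * ∏ i, (1 + (ν i : ℝ) ^ 2))
    (hu : ∀ x ∈ unitCube d, u x = ∑' ν, c ν * eigfn ν x)
    (hf : ∀ x ∈ openCube d, f x = -∑' ν, c ν * (∑ i, (Real.pi * ν i) ^ 2) * eigfn ν x)
    (hτ : ∀ (S : Finset (Fin d)) (lvl : Fin d → ℕ) (x : Fin d → ℝ),
      |∑' ν, c ν * (∏ s ∈ S, trunc (lvl s) (ν s)) * eigfn ν x| ≤ K / 12 ^ S.card) :
    ∃ w : Finset (Fin d) → (Fin d → ℕ) → (Fin d → ℝ) → ℝ,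
      (∀ (J : Finset (Fin d)) (lvl lvl' : Fin d → ℕ),
        (∀ j ∈ J, lvl j = lvl' j) → w J lvl = w J lvl') ∧
      (∀ J : Finset (Fin d), J.Nonempty → ∀ lvl : Fin d → ℕ,
        ContinuousOn (w J lvl) (Iplane d J lvl) ∧
        ∀ x ∈ Iplane d J lvl,
          |w J lvl x| ≤ K * (Nat.factorial J.card : ℝ) / (96 : ℝ) ^ J.card) ∧
      (∀ lvl : Fin d → ℕ, ∀ U : (Fin d → ℕ) → ℝ, IsFDPoisson d lvl f U →
        ∀ i : Fin d → ℕ, IsGridIdx d lvl i →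
          u (gridpt d lvl i) - U i =
            ∑ J ∈ Finset.univ.filter (fun J : Finset (Fin d) => J.Nonempty),
              w J lvl (gridpt d lvl i) * ∏ j ∈ J, hmesh d lvl j ^ 2) := by
  have hsum : ∀ J lvl, Summable fun ν => c ν * errCoef lvl ν J := by
    intro J lvl
    simpa using summable_errCoef hc lvl (Finset.disjoint_empty_right J)
  refine ⟨fun J lvl x => -∑' ν, c ν * errCoef lvl ν J * eigfn ν x, ?_, ?_, ?_⟩
  · intro J lvl lvl' h
    funext x
    simp_rw [fun ν => errCoef_congr ν J h]
  · intro J _ lvl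
    refine ⟨(continuous_sineSeries (hsum J lvl)).neg.continuousOn, fun x hx => ?_⟩
    rw [abs_neg]
    simpa using abs_errSeries_le hd hc hτ lvl J ∅ (Finset.disjoint_empty_right J) x hx
  · intro lvl U hU i hi
    let a : (Fin d → ℕ) → ℝ := fun ν =>
      ∑ J : Finset (Fin d), (∏ j ∈ J, hmesh d lvl j ^ 2) * (c ν * errCoef lvl ν J)
    have ha : Summable a := summable_sum fun J _ => (hsum J lvl).mul_left _
    have hUa : U i = ∑' ν, a ν * eigfn ν (gridpt d lvl i) := by
      have := abs_le_of_abs_discLap_le lvl hd le_rfl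
        (U := fun i => U i - ∑' ν, a ν * eigfn ν (gridpt d lvl i))
        (fun i hi hbd => by simp [eigfn_gridpt_boundary hbd, hU.1 i hi hbd])
        (fun i hi => ?_) i hi
      · rw [zero_div] at this
        exact sub_eq_zero.1 (abs_nonpos_iff.1 this)
      · have hgi : IsGridIdx d lvl i := fun k => (hi k).2.le
        have hopen : gridpt d lvl i ∈ openCube d := by
          intro k _
          have h1 : (0 : ℝ) < i k := by exact_mod_cast (hi k).1
          have h2 : (i k : ℝ) < 2 ^ lvl k := by exact_mod_cast (hi k).2
          refine ⟨mul_pos h1 (hmesh_pos lvl k), ?_⟩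
          simp only [gridpt, hmesh]
          rw [← div_eq_mul_inv, div_lt_one (by positivity)]
          exact h2
        rw [discLap_sub lvl U fun i => ∑' ν, a ν * eigfn ν (gridpt d lvl i),
          discLap_sineSeries ha _ _ fun k => (hi k).1,
          show discLap lvl U i = _ from hU.2 i hi, hf _ hopen]
        refine le_of_eq (abs_eq_zero.2 ?_)
        rw [sub_neg_eq_add, neg_add_eq_zero]
        refine tsum_congr fun ν => ?_
        by_cases h0 : lam Finset.univ lvl ν = 0
        · simp [eigfn_eq_zero_of_lam_eq_zero hd h0 (gridpt_mem_Iplane hgi _)]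
        · rw [← lam_univ_mul_sum_errCoef h0]
          congr 1
          simp only [a, Finset.mul_sum, Finset.sum_mul]
          exact Finset.sum_congr rfl fun J _ => by ring
    have hexp : ∑' ν, a ν * eigfn ν (gridpt d lvl i) = ∑ J : Finset (Fin d),
        (∏ j ∈ J, hmesh d lvl j ^ 2) * ∑' ν, c ν * errCoef lvl ν J * eigfn ν (gridpt d lvl i) := by
      simp_rw [← tsum_mul_left]
      rw [← Summable.tsum_finsetSum fun J _ => (summable_mul_eigfn (hsum J lvl) _).mul_left _]
      refine tsum_congr fun ν => ?_
      simp only [a, Finset.sum_mul]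
      exact Finset.sum_congr rfl fun J _ => by ring
    have hfilter : Finset.univ.filter (fun J : Finset (Fin d) => J.Nonempty) =
        Finset.univ.erase ∅ := by
      ext J; simp [Finset.nonempty_iff_ne_empty]
    rw [hUa, hexp, hu _ (gridpt_mem_unitCube hi), hfilter,
      ← Finset.add_sum_erase _ _ (Finset.mem_univ (∅ : Finset (Fin d)))]
    simp only [errCoef_empty, Finset.prod_empty, one_mul, mul_one, sub_add_cancel_left]
    rw [← Finset.sum_neg_distrib]
    exact Finset.sum_congr rfl fun J _ => by ring

lemma tendsto_piFinset_range :
    Filter.Tendsto (fun N : ℕ => Fintype.piFinset fun _ : Fin d => Finset.range N)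
      Filter.atTop Filter.atTop := by
  refine Filter.tendsto_atTop_finset_of_monotone (fun M N h ν hν => ?_) fun ν => ?_
  · rw [Fintype.mem_piFinset] at hν ⊢
    exact fun i => Finset.range_mono h (hν i)
  · refine ⟨(∑ i, ν i) + 1, Fintype.mem_piFinset.2 fun i => Finset.mem_range.2 ?_⟩
    exact Nat.lt_succ_of_le (Finset.single_le_sum (fun _ _ => Nat.zero_le _) (Finset.mem_univ i))

lemma summable_prod_of_summable {a : Fin d → ℕ → ℝ} (ha : ∀ i, Summable fun n => |a i n|) :
    Summable fun ν : Fin d → ℕ => ∏ i, a i (ν i) := by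
  refine Summable.of_abs ?_
  simp_rw [Finset.abs_prod]
  refine summable_of_sum_le (c := ∏ i, ∑' n, |a i n|)
    (fun ν => Finset.prod_nonneg fun _ _ => abs_nonneg _) fun s => ?_
  obtain ⟨N, hN⟩ := (tendsto_piFinset_range.eventually (Filter.eventually_ge_atTop s)).exists
  calc _ ≤ ∑ ν ∈ Fintype.piFinset fun _ : Fin d => Finset.range N, ∏ i, |a i (ν i)| :=
        Finset.sum_le_sum_of_subset_of_nonneg hN fun _ _ _ =>
          Finset.prod_nonneg fun _ _ => abs_nonneg _
    _ = ∏ i, ∑ n ∈ Finset.range N, |a i n| :=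
        (Finset.prod_univ_sum (fun _ => Finset.range N) fun i n => |a i n|).symm
    _ ≤ _ := Finset.prod_le_prod (fun _ _ => Finset.sum_nonneg fun _ _ => abs_nonneg _)
        fun i _ => (ha i).sum_le_tsum _ fun _ _ => abs_nonneg _

lemma tsum_prod_of_summable {a : Fin d → ℕ → ℝ} (ha : ∀ i, Summable fun n => |a i n|) :
    ∑' ν : Fin d → ℕ, ∏ i, a i (ν i) = ∏ i, ∑' n, a i n := by
  refine tendsto_nhds_unique
    ((summable_prod_of_summable ha).hasSum.comp tendsto_piFinset_range) ?_
  have : Filter.Tendsto (fun N => ∏ i, ∑ n ∈ Finset.range N, a i n) Filter.atTop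
      (nhds (∏ i, ∑' n, a i n)) :=
    tendsto_finsetProd _ fun i _ => (ha i).of_abs.hasSum.tendsto_sum_nat
  exact this.congr fun N => Finset.prod_univ_sum _ _

/-- Lebesgue measure on the unit cube. -/
noncomputable def cubeMeas (d : ℕ) : Measure (Fin d → ℝ) := volume.restrict (unitCube d)

lemma unitCube_eq_pi : unitCube d = Set.univ.pi fun _ => Set.Icc (0 : ℝ) 1 := by
  rw [unitCube, ← Set.pi_univ_Icc]; rfl

lemma cubeMeas_eq_pi :
    cubeMeas d = Measure.pi fun _ => volume.restrict (Set.Icc (0 : ℝ) 1) := by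
  rw [cubeMeas, unitCube_eq_pi, ← Measure.restrict_pi_pi]; rfl

instance : IsProbabilityMeasure (volume.restrict (Set.Icc (0 : ℝ) 1)) :=
  ⟨by simp⟩

instance : IsProbabilityMeasure (cubeMeas d) := by
  rw [cubeMeas_eq_pi]; infer_instance

lemma isCompact_unitCube : IsCompact (unitCube d) := by
  rw [unitCube_eq_pi]; exact isCompact_univ_pi fun _ => isCompact_Icc

lemma measurableSet_unitCube : MeasurableSet (unitCube d) := isCompact_unitCube.measurableSet

lemma integrable_cubeMeas {g : (Fin d → ℝ) → ℝ} (hg : ContinuousOn g (unitCube d)) :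
    Integrable g (cubeMeas d) := hg.integrableOn_compact isCompact_unitCube

lemma ae_cubeMeas {p : (Fin d → ℝ) → Prop} (h : ∀ x ∈ unitCube d, p x) :
    ∀ᵐ x ∂cubeMeas d, p x :=
  ae_restrict_of_forall_mem measurableSet_unitCube h

lemma abs_integral_cubeMeas_le {g : (Fin d → ℝ) → ℝ} {C : ℝ}
    (h : ∀ x ∈ unitCube d, |g x| ≤ C) : |∫ x, g x ∂cubeMeas d| ≤ C := by
  have := norm_integral_le_of_norm_le_const (μ := cubeMeas d) (f := g) (C := C) (ae_cubeMeas h)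
  simpa using this

lemma update_mem_unitCube {x : Fin d → ℝ} (hx : x ∈ unitCube d) (i : Fin d) {t : ℝ}
    (ht : t ∈ Set.Icc (0 : ℝ) 1) : Function.update x i t ∈ unitCube d := by
  rw [unitCube_eq_pi] at hx ⊢
  intro j _
  by_cases h : j = i
  · subst h; simpa using ht
  · simpa [h] using hx j trivial

lemma apply_mem_Icc {x : Fin d → ℝ} (hx : x ∈ unitCube d) (i : Fin d) :
    x i ∈ Set.Icc (0 : ℝ) 1 := ⟨hx.1 i, hx.2 i⟩

lemma measurePreserving_update (i : Fin d) :
    MeasurePreserving (fun p : (Fin d → ℝ) × ℝ => Function.update p.1 i p.2)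
      ((cubeMeas d).prod (volume.restrict (Set.Icc (0 : ℝ) 1))) (cubeMeas d) := by
  have hm : Measurable fun p : (Fin d → ℝ) × ℝ => Function.update p.1 i p.2 := by
    refine measurable_pi_lambda _ fun j => ?_
    by_cases h : j = i
    · subst h; simpa using measurable_snd
    · simp only [Function.update_of_ne h]; fun_prop
  refine ⟨hm, ?_⟩
  rw [cubeMeas_eq_pi]
  refine (Measure.pi_eq fun s hs => ?_).symm
  rw [Measure.map_apply hm (MeasurableSet.univ_pi hs)]
  have : (fun p : (Fin d → ℝ) × ℝ => Function.update p.1 i p.2) ⁻¹' Set.univ.pi s =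
      (Set.univ.pi (Function.update s i Set.univ)) ×ˢ s i := by
    ext ⟨x, t⟩
    simp only [Set.mem_preimage, Set.mem_pi, Set.mem_univ, true_imp_iff, Set.mem_prod]
    constructor
    · refine fun h => ⟨fun j => ?_, by simpa using h i⟩
      by_cases hj : j = i
      · subst hj; simp
      · simpa [hj] using h j
    · rintro ⟨h, ht⟩ j
      by_cases hj : j = i
      · subst hj; simpa using ht
      · simpa [hj] using h j
  rw [this, Measure.prod_prod, Measure.pi_pi, ← Finset.prod_erase_mul _ _ (Finset.mem_univ i),
    ← Finset.prod_erase_mul (a := i) _ (fun j => (volume.restrict (Set.Icc (0 : ℝ) 1)) (s j))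
      (Finset.mem_univ i)]
  congr 1
  rw [Function.update_self, measure_univ, mul_one]
  exact Finset.prod_congr rfl fun j hj => by
    rw [Function.update_of_ne (Finset.ne_of_mem_erase hj)]

lemma integral_eq_integral_update {G : (Fin d → ℝ) → ℝ} (hG : Integrable G (cubeMeas d))
    (i : Fin d) :
    ∫ x, G x ∂cubeMeas d =
      ∫ x, (∫ t in (0 : ℝ)..1, G (Function.update x i t)) ∂cubeMeas d := by
  have hp := measurePreserving_update i
  have h1 : ∫ x, G x ∂cubeMeas d =
      ∫ p, G (Function.update p.1 i p.2)
        ∂((cubeMeas d).prod (volume.restrict (Set.Icc (0 : ℝ) 1))) := by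
    conv_lhs => rw [← hp.map_eq]
    exact integral_map hp.measurable.aemeasurable (hp.map_eq.symm ▸ hG.aestronglyMeasurable)
  rw [h1]
  refine (integral_prod _ (hp.integrable_comp_of_integrable hG)).trans ?_
  refine integral_congr_ae (Filter.Eventually.of_forall fun x => ?_)
  simp only [Function.comp_apply]
  rw [intervalIntegral.integral_of_le zero_le_one, integral_Icc_eq_integral_Ioc]

lemma integral_cos_int (k : ℤ) :
    ∫ t in (0 : ℝ)..1, Real.cos (Real.pi * k * t) = if k = 0 then 1 else 0 := by
  split_ifs with h
  · simp [h]
  · have hk : Real.pi * k ≠ 0 := mul_ne_zero Real.pi_ne_zero (by exact_mod_cast h)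
    rw [intervalIntegral.integral_comp_mul_left (fun t => Real.cos t) hk, integral_cos]
    simp [mul_comm Real.pi, Real.sin_int_mul_pi]

lemma integral_sin_mul_sin (m n : ℕ) :
    ∫ t in (0 : ℝ)..1, Real.sin (Real.pi * m * t) * Real.sin (Real.pi * n * t) =
      if m = n ∧ n ≠ 0 then 1 / 2 else 0 := by
  have h : ∀ t : ℝ, Real.sin (Real.pi * m * t) * Real.sin (Real.pi * n * t) =
      (1 / 2) * (Real.cos (Real.pi * ((m - n : ℤ) : ℝ) * t) -
        Real.cos (Real.pi * ((m + n : ℤ) : ℝ) * t)) := by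
    intro t
    push_cast
    rw [mul_sub Real.pi, sub_mul, Real.cos_sub, mul_add, add_mul, Real.cos_add]
    ring
  simp_rw [h]
  rw [intervalIntegral.integral_const_mul, intervalIntegral.integral_sub
    (Continuous.intervalIntegrable (by fun_prop) _ _)
    (Continuous.intervalIntegrable (by fun_prop) _ _), integral_cos_int, integral_cos_int]
  by_cases h1 : m = n
  · subst h1
    by_cases h2 : m = 0
    · simp [h2]
    · have : (m + m : ℤ) ≠ 0 := by omega
      simp [h2, this]
  · have h2 : (m - n : ℤ) ≠ 0 := by omega
    have h3 : (m + n : ℤ) ≠ 0 := by omega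
    simp [h1, h2, h3]

lemma integral_eigfn_mul_eigfn (ν μ : Fin d → ℕ) :
    ∫ x, eigfn ν x * eigfn μ x ∂cubeMeas d =
      if ν = μ ∧ ∀ i, μ i ≠ 0 then (1 / 2) ^ d else 0 := by
  simp_rw [eigfn, ← Finset.prod_mul_distrib]
  rw [cubeMeas_eq_pi, integral_fintype_prod_eq_prod
    (fun i t => Real.sin (Real.pi * ν i * t) * Real.sin (Real.pi * μ i * t))]
  simp_rw [integral_Icc_eq_integral_Ioc, ← intervalIntegral.integral_of_le zero_le_one,
    integral_sin_mul_sin]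
  split_ifs with h
  · obtain ⟨rfl, h⟩ := h
    simp [h]
  · by_cases h1 : ν = μ
    · subst h1
      push Not at h
      obtain ⟨i, hi⟩ := h rfl
      exact Finset.prod_eq_zero (Finset.mem_univ i) (by simp [hi])
    · obtain ⟨i, hi⟩ := Function.ne_iff.1 h1
      exact Finset.prod_eq_zero (Finset.mem_univ i) (by simp [hi])

/-- The sine Fourier coefficients of a function on the unit cube. -/
noncomputable def sineCoef (v : (Fin d → ℝ) → ℝ) (ν : Fin d → ℕ) : ℝ :=
  2 ^ d * ∫ x, v x * eigfn ν x ∂cubeMeas d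

lemma eigfn_eq_zero_of_eq_zero {ν : Fin d → ℕ} {i : Fin d} (h : ν i = 0) (x : Fin d → ℝ) :
    eigfn ν x = 0 := eigfn_eq_zero_of_sin i (by simp [h])

lemma sineCoef_eq_zero_of_eq_zero (v : (Fin d → ℝ) → ℝ) {ν : Fin d → ℕ} {i : Fin d}
    (h : ν i = 0) : sineCoef v ν = 0 := by
  simp [sineCoef, eigfn_eq_zero_of_eq_zero h]

lemma sineCoef_sineSeries {b : (Fin d → ℕ) → ℝ} (hb : Summable b) {μ : Fin d → ℕ}
    (hμ : ∀ i, μ i ≠ 0) : sineCoef (fun x => ∑' ν, b ν * eigfn ν x) μ = b μ := by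
  have h1 : ∀ ν, Continuous fun x => b ν * eigfn ν x * eigfn μ x := fun ν =>
    ((continuous_eigfn ν).const_mul (b ν)).mul (continuous_eigfn μ)
  have h2 := hasSum_integral_of_summable_integral_norm (μ := cubeMeas d)
    (F := fun ν x => b ν * eigfn ν x * eigfn μ x)
    (fun ν => integrable_cubeMeas (h1 ν).continuousOn) ?_
  · simp_rw [sineCoef, ← tsum_mul_right]
    rw [← h2.tsum_eq]
    simp_rw [mul_assoc, integral_const_mul, integral_eigfn_mul_eigfn]
    rw [tsum_eq_single μ fun ν hν => by simp [hν]]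
    rw [if_pos ⟨rfl, hμ⟩]
    rw [mul_left_comm, ← mul_pow]
    norm_num
  · refine Summable.of_nonneg_of_le (fun ν => integral_nonneg fun _ => norm_nonneg _)
      (fun ν => ?_) hb.abs
    refine (le_abs_self _).trans (abs_integral_cubeMeas_le fun x _ => ?_)
    rw [abs_norm, Real.norm_eq_abs, abs_mul, abs_mul, mul_assoc]
    exact mul_le_of_le_one_right (abs_nonneg _)
      (mul_le_one₀ (abs_eigfn_le_one _ _) (abs_nonneg _) (abs_eigfn_le_one _ _))

lemma eigfn_mul_cos {ν : Fin d → ℕ} {i : Fin d} (h : ν i ≠ 0) (x : Fin d → ℝ) :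
    eigfn ν x * Real.cos (Real.pi * x i) =
      (eigfn (Function.update ν i (ν i + 1)) x + eigfn (Function.update ν i (ν i - 1)) x) / 2 := by
  have hp : ∀ n, eigfn (Function.update ν i n) x = Real.sin (Real.pi * n * x i) *
      ∏ j ∈ Finset.univ.erase i, Real.sin (Real.pi * ν j * x j) := by
    intro n
    rw [eigfn_eq_mul _ x i, Function.update_self]
    congr 1
    exact Finset.prod_congr rfl fun j hj => by
      rw [Function.update_of_ne (Finset.ne_of_mem_erase hj)]
  rw [hp, hp, eigfn_eq_mul ν x i, Nat.cast_sub (Nat.one_le_iff_ne_zero.2 h)]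
  push_cast
  rw [show Real.pi * (ν i + 1) * x i = Real.pi * ν i * x i + Real.pi * x i by ring,
    show Real.pi * (ν i - 1) * x i = Real.pi * ν i * x i - Real.pi * x i by ring,
    Real.sin_add, Real.sin_sub]
  ring

/-- The nearest point retraction onto the cube. -/
noncomputable def cubeRetract (x : Fin d → ℝ) : Fin d → Set.Icc (0 : ℝ) 1 :=
  fun i => Set.projIcc 0 1 zero_le_one (x i)

lemma continuous_cubeRetract : Continuous (cubeRetract (d := d)) :=
  continuous_pi fun i => continuous_projIcc.comp (continuous_apply i)

lemma cubeRetract_of_mem {x : Fin d → ℝ} (hx : x ∈ unitCube d) (i : Fin d) :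
    (cubeRetract x i : ℝ) = x i := by
  rw [cubeRetract, Set.projIcc_of_mem _ (apply_mem_Icc hx i)]

/-- The continuous function `cos(π xᵢ)` on the cube. -/
noncomputable def cosMap (i : Fin d) : C(Fin d → Set.Icc (0 : ℝ) 1, ℝ) :=
  ⟨fun y => Real.cos (Real.pi * y i), by fun_prop⟩

lemma separatesPoints_adjoin_cosMap :
    (Algebra.adjoin ℝ (Set.range (cosMap (d := d)))).SeparatesPoints := by
  intro y z hyz
  obtain ⟨i, hi⟩ := Function.ne_iff.1 hyz
  refine ⟨cosMap i, ⟨cosMap i, Algebra.subset_adjoin ⟨i, rfl⟩, rfl⟩, fun h => hi ?_⟩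
  have hm : ∀ t : Set.Icc (0 : ℝ) 1, Real.pi * t ∈ Set.Icc 0 Real.pi := fun t =>
    ⟨mul_nonneg Real.pi_pos.le t.2.1, mul_le_of_le_one_right Real.pi_pos.le t.2.2⟩
  exact Subtype.ext (mul_left_cancel₀ Real.pi_ne_zero (Real.injOn_cos (hm _) (hm _) h))

section Completeness

variable {v : (Fin d → ℝ) → ℝ}

lemma integrable_mul_eigfn_mul (hv : ContinuousOn v (unitCube d)) (ν : Fin d → ℕ)
    (w : C(Fin d → Set.Icc (0 : ℝ) 1, ℝ)) :
    Integrable (fun x => v x * eigfn ν x * w (cubeRetract x)) (cubeMeas d) :=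
  integrable_cubeMeas ((hv.mul (continuous_eigfn ν).continuousOn).mul
    (w.continuous.comp continuous_cubeRetract).continuousOn)

lemma integral_mul_adjoin_eq_zero (hv : ContinuousOn v (unitCube d))
    (h0 : ∀ ν, sineCoef v ν = 0) {w : C(Fin d → Set.Icc (0 : ℝ) 1, ℝ)}
    (hw : w ∈ Algebra.adjoin ℝ (Set.range (cosMap (d := d)))) (ν : Fin d → ℕ) :
    ∫ x, v x * eigfn ν x * w (cubeRetract x) ∂cubeMeas d = 0 := by
  suffices H : ∀ p : C(Fin d → Set.Icc (0 : ℝ) 1, ℝ),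
      (∀ ν, ∫ x, v x * eigfn ν x * p (cubeRetract x) ∂cubeMeas d = 0) →
      ∀ ν, ∫ x, v x * eigfn ν x * (w * p) (cubeRetract x) ∂cubeMeas d = 0 by
    have := H 1 (fun ν => by simpa [sineCoef] using h0 ν) ν
    simpa using this
  clear ν
  induction hw using Algebra.adjoin_induction with
  | mem w hw =>
    obtain ⟨i, rfl⟩ := hw
    intro p hp ν
    by_cases hi : ν i = 0
    · simp [eigfn_eq_zero_of_eq_zero hi]
    have : ∀ᵐ x ∂cubeMeas d, v x * eigfn ν x * (cosMap i * p) (cubeRetract x) =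
        (1 / 2) * (v x * eigfn (Function.update ν i (ν i + 1)) x * p (cubeRetract x) +
          v x * eigfn (Function.update ν i (ν i - 1)) x * p (cubeRetract x)) := by
      refine ae_cubeMeas fun x hx => ?_
      have h := eigfn_mul_cos hi x
      simp only [ContinuousMap.mul_apply, cosMap, ContinuousMap.coe_mk, cubeRetract_of_mem hx]
      linear_combination v x * p (cubeRetract x) * h
    rw [integral_congr_ae this, integral_const_mul, integral_add
      (integrable_mul_eigfn_mul hv _ p) (integrable_mul_eigfn_mul hv _ p), hp, hp]
    simp
  | algebraMap r =>
    intro p hp ν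
    have : ∀ x, v x * eigfn ν x * (algebraMap ℝ C(Fin d → Set.Icc (0 : ℝ) 1, ℝ) r * p)
        (cubeRetract x) = r * (v x * eigfn ν x * p (cubeRetract x)) := by
      intro x; simp; ring
    simp_rw [this, integral_const_mul, hp, mul_zero]
  | add w₁ w₂ _ _ h₁ h₂ =>
    intro p hp ν
    simp_rw [add_mul, ContinuousMap.add_apply, mul_add]
    rw [integral_add (integrable_mul_eigfn_mul hv _ _) (integrable_mul_eigfn_mul hv _ _),
      h₁ p hp, h₂ p hp, add_zero]
  | mul w₁ w₂ _ _ h₁ h₂ =>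
    intro p hp ν
    rw [mul_assoc]
    exact h₁ _ (h₂ p hp) ν

lemma integral_mul_eq_zero (hv : ContinuousOn v (unitCube d)) (h0 : ∀ ν, sineCoef v ν = 0)
    (w : C(Fin d → Set.Icc (0 : ℝ) 1, ℝ)) (ν : Fin d → ℕ) :
    ∫ x, v x * eigfn ν x * w (cubeRetract x) ∂cubeMeas d = 0 := by
  obtain ⟨C, hC⟩ := isCompact_unitCube.exists_bound_of_continuousOn hv
  have hC0 : 0 ≤ C := (norm_nonneg _).trans (hC 0 ⟨le_rfl, zero_le_one⟩)
  refine abs_nonpos_iff.1 (le_of_forall_pos_le_add fun ε hε => ?_)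
  obtain ⟨g, hg⟩ := ContinuousMap.exists_mem_subalgebra_near_continuousMap_of_separatesPoints _
    separatesPoints_adjoin_cosMap w (ε / (C + 1)) (by positivity)
  have h1 : ∫ x, v x * eigfn ν x * w (cubeRetract x) ∂cubeMeas d =
      ∫ x, v x * eigfn ν x * (w - g : C(Fin d → Set.Icc (0 : ℝ) 1, ℝ)) (cubeRetract x)
        ∂cubeMeas d := by
    simp_rw [ContinuousMap.sub_apply, mul_sub]
    rw [integral_sub (integrable_mul_eigfn_mul hv _ _) (integrable_mul_eigfn_mul hv _ _),
      integral_mul_adjoin_eq_zero hv h0 g.2, sub_zero]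
  rw [h1, zero_add]
  refine abs_integral_cubeMeas_le fun x hx => ?_
  rw [abs_mul, abs_mul]
  calc _ ≤ C * 1 * (ε / (C + 1)) := by
        gcongr
        · exact hC x hx
        · exact abs_eigfn_le_one _ _
        · rw [← Real.norm_eq_abs]
          refine (ContinuousMap.norm_coe_le_norm _ _).trans ?_
          rw [norm_sub_rev]
          exact hg.le
    _ ≤ ε := by
        rw [mul_one, mul_div_assoc', div_le_iff₀ (by positivity)]
        nlinarith

/-- The sine system is complete on the cube. -/
lemma eq_zero_of_sineCoef_eq_zero (hv : ContinuousOn v (unitCube d))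
    (h0 : ∀ ν, sineCoef v ν = 0) {x : Fin d → ℝ} (hx : x ∈ openCube d) : v x = 0 := by
  have hsub : openCube d ⊆ unitCube d := by
    rw [unitCube_eq_pi]
    exact Set.pi_mono fun _ _ => Set.Ioo_subset_Icc_self
  have hopen : IsOpen (openCube d) := isOpen_set_pi Set.finite_univ fun _ _ => isOpen_Ioo
  have hcont : Continuous fun y : Fin d → Set.Icc (0 : ℝ) 1 => v fun i => y i :=
    hv.comp_continuous (by fun_prop) fun y => ⟨fun i => (y i).2.1, fun i => (y i).2.2⟩
  let w : C(Fin d → Set.Icc (0 : ℝ) 1, ℝ) :=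
    ⟨fun y => v (fun i => y i) * eigfn 1 fun i => y i,
      hcont.mul ((continuous_eigfn 1).comp (by fun_prop))⟩
  have h1 := integral_mul_eq_zero hv h0 w 1
  have h2 : ∫ y in unitCube d, (v y * eigfn 1 y) ^ 2 = 0 := by
    rw [← h1]
    refine integral_congr_ae (ae_cubeMeas fun y hy => ?_)
    simp only [w, ContinuousMap.coe_mk, cubeRetract_of_mem hy]
    ring
  have hInt : IntegrableOn (fun y => (v y * eigfn 1 y) ^ 2) (unitCube d) :=
    integrable_cubeMeas ((hv.mul (continuous_eigfn 1).continuousOn).pow 2)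
  have h3 : ∫ y in openCube d, (v y * eigfn 1 y) ^ 2 = 0 :=
    le_antisymm (h2 ▸ setIntegral_mono_set hInt
      (Filter.Eventually.of_forall fun _ => sq_nonneg _) hsub.eventuallyLE)
      (integral_nonneg fun _ => sq_nonneg _)
  have h4 := (integral_eq_zero_iff_of_nonneg (fun _ => sq_nonneg _) (hInt.mono_set hsub)).1 h3
  have h5 := Measure.eqOn_open_of_ae_eq h4 hopen
    (((hv.mul (continuous_eigfn 1).continuousOn).pow 2).mono hsub) continuousOn_const hx
  have h6 : eigfn 1 x ≠ 0 := Finset.prod_ne_zero_iff.2 fun i _ => by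
    have := hx i trivial
    refine (Real.sin_pos_of_pos_of_lt_pi ?_ ?_).ne'
    · simpa using mul_pos Real.pi_pos this.1
    · simpa using mul_lt_of_lt_one_right Real.pi_pos this.2
  simpa [h6] using h5

end Completeness

lemma foldr_pd_update (i : Fin d) (β : Fin d → ℕ) (hβ : ∀ k < i, β k = 0)
    (u : (Fin d → ℝ) → ℝ) (L : List (Fin d)) (hL : L.Pairwise (· < ·)) (hi : i ∈ L) :
    L.foldr (fun k v => (pd d k)^[Function.update β i (β i + 1) k] v) u =
      pd d i (L.foldr (fun k v => (pd d k)^[β k] v) u) := by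
  induction L with
  | nil => simp at hi
  | cons a L ih =>
    rw [List.pairwise_cons] at hL
    rw [List.foldr_cons, List.foldr_cons]
    by_cases h : a = i
    · subst h
      have : L.foldr (fun k v => (pd d k)^[Function.update β a (β a + 1) k] v) u =
          L.foldr (fun k v => (pd d k)^[β k] v) u :=
        List.foldr_ext _ _ _ fun k hk v => by rw [Function.update_of_ne (hL.1 k hk).ne']
      rw [this, Function.update_self, Function.iterate_succ_apply']
    · have hiL : i ∈ L := (List.mem_cons.1 hi).resolve_left (Ne.symm h)
      rw [Function.update_of_ne h, hβ a (hL.1 i hiL), Function.iterate_zero_apply,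
        Function.iterate_zero_apply, ih hL.2 hiL]

lemma mderiv_update_succ (i : Fin d) (β : Fin d → ℕ) (hβ : ∀ k < i, β k = 0)
    (u : (Fin d → ℝ) → ℝ) :
    mderiv d (Function.update β i (β i + 1)) u = pd d i (mderiv d β u) :=
  foldr_pd_update i β hβ u _ (List.pairwise_lt_finRange d) (List.mem_finRange i)

lemma mderiv_zero (u : (Fin d → ℝ) → ℝ) : mderiv d 0 u = u := by
  simp [mderiv]

lemma integral_deriv_deriv_mul_sin {g g' g'' : ℝ → ℝ} (n : ℕ)
    (hg : ∀ t ∈ Set.Icc (0 : ℝ) 1, HasDerivWithinAt g (g' t) (Set.Icc 0 1) t)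
    (hg' : ∀ t ∈ Set.Icc (0 : ℝ) 1, HasDerivWithinAt g' (g'' t) (Set.Icc 0 1) t)
    (hg'' : ContinuousOn g'' (Set.Icc 0 1)) (h0 : g 0 = 0) (h1 : g 1 = 0) :
    ∫ t in (0 : ℝ)..1, g'' t * Real.sin (Real.pi * n * t) =
      -(Real.pi * n) ^ 2 * ∫ t in (0 : ℝ)..1, g t * Real.sin (Real.pi * n * t) := by
  set a : ℝ := Real.pi * n with ha
  have hI : Set.uIcc (0 : ℝ) 1 = Set.Icc 0 1 := Set.uIcc_of_le zero_le_one
  have hlin : ∀ t : ℝ, HasDerivAt (fun t => a * t) a t := fun t => by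
    simpa using (hasDerivAt_id t).const_mul a
  have hsin : ∀ t : ℝ, HasDerivAt (fun t => Real.sin (a * t)) (a * Real.cos (a * t)) t :=
    fun t => by simpa [mul_comm] using (hlin t).sin
  have hcos : ∀ t : ℝ, HasDerivAt (fun t => Real.cos (a * t)) (-(a * Real.sin (a * t))) t :=
    fun t => by simpa [mul_comm] using (hlin t).cos
  have hg'c : ContinuousOn g' (Set.Icc 0 1) := fun t ht => (hg' t ht).continuousWithinAt
  have i1 := intervalIntegral.integral_mul_deriv_eq_deriv_mul_of_hasDerivWithinAt
    (a := 0) (b := 1) (u := fun t => Real.sin (a * t)) (v := g') (v' := g'')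
    (fun t _ => (hsin t).hasDerivWithinAt) (fun t ht => hI ▸ hg' t (hI ▸ ht))
    (Continuous.intervalIntegrable (by fun_prop) _ _)
    (ContinuousOn.intervalIntegrable (hI ▸ hg''))
  have i2 := intervalIntegral.integral_mul_deriv_eq_deriv_mul_of_hasDerivWithinAt
    (a := 0) (b := 1) (u := fun t => Real.cos (a * t)) (v := g) (v' := g')
    (fun t _ => (hcos t).hasDerivWithinAt) (fun t ht => hI ▸ hg t (hI ▸ ht))
    (Continuous.intervalIntegrable (by fun_prop) _ _)
    (ContinuousOn.intervalIntegrable (hI ▸ hg'c))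
  have hs : Real.sin (a * 1) = 0 := by
    rw [ha, mul_one, mul_comm]; exact Real.sin_nat_mul_pi n
  have e1 : ∫ t in (0 : ℝ)..1, g'' t * Real.sin (a * t) =
      -(a * ∫ t in (0 : ℝ)..1, Real.cos (a * t) * g' t) := by
    simp_rw [mul_comm (g'' _)]
    rw [i1, hs, mul_zero, Real.sin_zero, ← intervalIntegral.integral_const_mul]
    simp_rw [mul_assoc]
    ring
  have e2 : ∫ t in (0 : ℝ)..1, Real.cos (a * t) * g' t =
      a * ∫ t in (0 : ℝ)..1, g t * Real.sin (a * t) := by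
    rw [i2, h0, h1, ← intervalIntegral.integral_const_mul, mul_zero, mul_zero, sub_zero, zero_sub,
      ← intervalIntegral.integral_neg]
    refine intervalIntegral.integral_congr fun t _ => ?_
    ring
  rw [e1, e2]
  ring

lemma pd_update (i : Fin d) (v : (Fin d → ℝ) → ℝ) (x : Fin d → ℝ) (t : ℝ) :
    pd d i v (Function.update x i t) =
      derivWithin (fun s => v (Function.update x i s)) (Set.Icc 0 1) t := by
  simp [pd]

lemma hasDerivWithinAt_update {i : Fin d} {v : (Fin d → ℝ) → ℝ}
    (hv : ∀ x ∈ unitCube d, DifferentiableWithinAt ℝ (fun t => v (Function.update x i t))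
      (Set.Icc 0 1) (x i)) {x : Fin d → ℝ} (hx : x ∈ unitCube d) {t : ℝ}
    (ht : t ∈ Set.Icc (0 : ℝ) 1) :
    HasDerivWithinAt (fun s => v (Function.update x i s)) (pd d i v (Function.update x i t))
      (Set.Icc 0 1) t := by
  have := hv _ (update_mem_unitCube hx i ht)
  simp only [Function.update_idem, Function.update_self] at this
  rw [pd_update]
  exact this.hasDerivWithinAt

lemma update_zero_mem_cubeBdry {x : Fin d → ℝ} (hx : x ∈ unitCube d) (i : Fin d) :
    Function.update x i 0 ∈ cubeBdry d :=
  ⟨update_mem_unitCube hx i ⟨le_rfl, zero_le_one⟩, i, by simp⟩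

lemma update_one_mem_cubeBdry {x : Fin d → ℝ} (hx : x ∈ unitCube d) (i : Fin d) :
    Function.update x i 1 ∈ cubeBdry d :=
  ⟨update_mem_unitCube hx i ⟨zero_le_one, le_rfl⟩, i, by simp⟩

lemma integrable_mul_eigfn {v : (Fin d → ℝ) → ℝ} (hv : ContinuousOn v (unitCube d))
    (ν : Fin d → ℕ) : Integrable (fun x => v x * eigfn ν x) (cubeMeas d) :=
  integrable_cubeMeas (hv.mul (continuous_eigfn ν).continuousOn)

lemma sineCoef_pd_pd {i : Fin d} {v : (Fin d → ℝ) → ℝ}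
    (hv : ∀ x ∈ unitCube d, DifferentiableWithinAt ℝ (fun t => v (Function.update x i t))
      (Set.Icc 0 1) (x i))
    (hv' : ∀ x ∈ unitCube d, DifferentiableWithinAt ℝ
      (fun t => pd d i v (Function.update x i t)) (Set.Icc 0 1) (x i))
    (hc : ContinuousOn v (unitCube d)) (hc' : ContinuousOn (pd d i (pd d i v)) (unitCube d))
    (h0 : ∀ x ∈ cubeBdry d, v x = 0) (ν : Fin d → ℕ) :
    sineCoef (pd d i (pd d i v)) ν = -(Real.pi * ν i) ^ 2 * sineCoef v ν := by
  rw [sineCoef, sineCoef, mul_left_comm]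
  congr 1
  rw [integral_eq_integral_update (integrable_mul_eigfn hc' ν) i,
    integral_eq_integral_update (integrable_mul_eigfn hc ν) i,
    ← integral_const_mul]
  refine integral_congr_ae (ae_cubeMeas fun x hx => ?_)
  simp only [eigfn_update, ← mul_assoc, intervalIntegral.integral_mul_const]
  congr 1
  refine integral_deriv_deriv_mul_sin (ν i)
    (g := fun t => v (Function.update x i t)) (g' := fun t => pd d i v (Function.update x i t))
    (g'' := fun t => pd d i (pd d i v) (Function.update x i t))
    (fun t ht => hasDerivWithinAt_update hv hx ht)
    (fun t ht => hasDerivWithinAt_update hv' hx ht)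
    (hc'.comp (by fun_prop) fun t ht => update_mem_unitCube hx i ht)
    (h0 _ (update_zero_mem_cubeBdry hx i)) (h0 _ (update_one_mem_cubeBdry hx i))

lemma mderiv_update_add_two (i : Fin d) (β : Fin d → ℕ) (hβ : ∀ k < i, β k = 0)
    (u : (Fin d → ℝ) → ℝ) :
    mderiv d (Function.update β i (β i + 2)) u = pd d i (pd d i (mderiv d β u)) := by
  rw [← mderiv_update_succ i β hβ, ← mderiv_update_succ i _ fun k hk => by
    rw [Function.update_of_ne hk.ne, hβ k hk]]
  simp

section

variable {u : (Fin d → ℝ) → ℝ}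

lemma sineCoef_mderiv_update (hu : MemX d 4 u) {i : Fin d} {β : Fin d → ℕ}
    (hβ4 : ∀ k, β k ≤ 4) (hβi : β i ≤ 2) (hβ : ∀ k < i, β k = 0) (ν : Fin d → ℕ) :
    sineCoef (mderiv d (Function.update β i (β i + 2)) u) ν =
      -(Real.pi * ν i) ^ 2 * sineCoef (mderiv d β u) ν := by
  have hle : ∀ n ≤ 4, ∀ k, Function.update β i n k ≤ 4 := fun n hn k => by
    by_cases h : k = i
    · subst h; simpa using hn
    · simpa [h] using hβ4 k
  rw [mderiv_update_add_two i β hβ]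
  refine sineCoef_pd_pd (hu.1 β hβ4 i (lt_of_le_of_lt hβi (by norm_num))) ?_ (hu.2 β hβ4).1 ?_ (hu.2 β hβ4).2 ν
  · rw [← mderiv_update_succ i β hβ]
    exact hu.1 _ (hle _ (by omega)) i (by
      rw [Function.update_self]
      exact lt_of_le_of_lt (Nat.succ_le_succ hβi) (by norm_num))
  · rw [← mderiv_update_add_two i β hβ]
    exact (hu.2 _ (hle _ (by omega))).1

/-- The multi-index of order four in the directions of `S`. -/
def fourOn (S : Finset (Fin d)) : Fin d → ℕ := fun i => if i ∈ S then 4 else 0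

lemma fourOn_le (S : Finset (Fin d)) (i : Fin d) : fourOn S i ≤ 4 := by
  unfold fourOn; split_ifs <;> simp

lemma sineCoef_mderiv_fourOn (hu : MemX d 4 u) (S : Finset (Fin d)) (ν : Fin d → ℕ) :
    sineCoef (mderiv d (fourOn S) u) ν = (∏ i ∈ S, (Real.pi * ν i) ^ 4) * sineCoef u ν := by
  induction S using Finset.induction_on_min with
  | empty =>
    have : fourOn (∅ : Finset (Fin d)) = 0 := by ext; simp [fourOn]
    simp [this, mderiv_zero]
  | insert i S hi ih =>
    have hiS : i ∉ S := fun h => lt_irrefl _ (hi i h)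
    have hβ : ∀ k ≤ i, fourOn S k = 0 := fun k hk =>
      if_neg fun h => (hi k h).not_ge hk
    have h1 := sineCoef_mderiv_update hu (fourOn_le S) (by rw [hβ i le_rfl]; omega)
      (fun k hk => hβ k hk.le) ν
    have h2 := sineCoef_mderiv_update hu (i := i)
      (β := Function.update (fourOn S) i (fourOn S i + 2)) (fun k => by
        by_cases h : k = i
        · subst h; simp [hβ]
        · simpa [h] using fourOn_le S k)
      (by simp [hβ]) (fun k hk => by rw [Function.update_of_ne hk.ne, hβ k hk.le]) ν
    have h3 : Function.update (Function.update (fourOn S) i (fourOn S i + 2)) i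
        (Function.update (fourOn S) i (fourOn S i + 2) i + 2) = fourOn (insert i S) := by
      ext k
      by_cases h : k = i
      · subst h; simp [hiS, fourOn]
      · simp [h, fourOn]
    rw [h3] at h2
    rw [h2, h1, ih, Finset.prod_insert hiS]
    ring

lemma abs_sineCoef_le {v : (Fin d → ℝ) → ℝ} {K : ℝ} (h : ∀ x ∈ unitCube d, |v x| ≤ K)
    (ν : Fin d → ℕ) : |sineCoef v ν| ≤ 2 ^ d * K := by
  rw [sineCoef, abs_mul, abs_of_nonneg (by positivity : (0 : ℝ) ≤ 2 ^ d)]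
  refine mul_le_mul_of_nonneg_left (abs_integral_cubeMeas_le fun x hx => ?_) (by positivity)
  rw [abs_mul]
  exact (mul_le_of_le_one_right (abs_nonneg _) (abs_eigfn_le_one _ _)).trans (h x hx)

lemma abs_sineCoef_mul_le {K : ℝ} (hu : MemXb d 4 K u) (ν : Fin d → ℕ) :
    |sineCoef u ν| * ∏ i, (1 + (ν i : ℝ) ^ 2) ≤
      2 ^ d * K * ∏ i, (if ν i = 0 then 0 else 2 / (ν i : ℝ) ^ 2) := by
  by_cases h : ∃ i, ν i = 0
  · obtain ⟨i, hi⟩ := h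
    rw [sineCoef_eq_zero_of_eq_zero u hi,
      Finset.prod_eq_zero (f := fun i => if ν i = 0 then 0 else 2 / (ν i : ℝ) ^ 2)
        (Finset.mem_univ i) (by simp [hi])]
    simp
  push Not at h
  have h1 := abs_sineCoef_le (hu.2 (fourOn Finset.univ) (fourOn_le _)) ν
  rw [sineCoef_mderiv_fourOn hu.1, abs_mul, Finset.abs_prod] at h1
  have hK : 0 ≤ 2 ^ d * K := (mul_nonneg (Finset.prod_nonneg fun _ _ => abs_nonneg _)
    (abs_nonneg _)).trans h1
  have h2 : ∀ i, 1 + (ν i : ℝ) ^ 2 ≤ |(Real.pi * ν i) ^ 4| * (2 / (ν i : ℝ) ^ 2) := by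
    intro i
    have hn : (1 : ℝ) ≤ ν i := by exact_mod_cast Nat.one_le_iff_ne_zero.2 (h i)
    have hpi : (1 : ℝ) ≤ Real.pi ^ 4 := one_le_pow₀ (by linarith [Real.pi_gt_three])
    rw [abs_of_nonneg (by positivity), mul_pow, mul_div_assoc', le_div_iff₀ (by positivity)]
    have h3 : (1 : ℝ) ≤ (ν i : ℝ) ^ 2 := one_le_pow₀ hn
    nlinarith [mul_le_mul_of_nonneg_right hpi (by positivity : (0 : ℝ) ≤ (ν i : ℝ) ^ 4)]
  calc _ ≤ |sineCoef u ν| * ∏ i, (|(Real.pi * ν i) ^ 4| * (2 / (ν i : ℝ) ^ 2)) := by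
        gcongr with i
        exact h2 i
    _ = (∏ i, |(Real.pi * ν i) ^ 4|) * |sineCoef u ν| * ∏ i, (2 / (ν i : ℝ) ^ 2) := by
        rw [Finset.prod_mul_distrib]; ring
    _ ≤ 2 ^ d * K * ∏ i, (2 / (ν i : ℝ) ^ 2) := by
        gcongr
    _ = _ := by simp [h]

lemma summable_sineCoef_mul {K : ℝ} (hu : MemXb d 4 K u) :
    Summable fun ν => |sineCoef u ν| * ∏ i, (1 + (ν i : ℝ) ^ 2) := by
  refine Summable.of_nonneg_of_le
    (fun ν => mul_nonneg (abs_nonneg _) (Finset.prod_nonneg fun _ _ => by positivity))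
    (abs_sineCoef_mul_le hu) (Summable.mul_left _ ?_)
  refine summable_prod_of_summable (a := fun _ n => if n = 0 then 0 else 2 / (n : ℝ) ^ 2)
    fun _ => ?_
  refine Summable.of_nonneg_of_le (fun _ => abs_nonneg _) (fun n => ?_)
    ((Real.summable_one_div_nat_pow.2 one_lt_two).mul_left 2)
  split_ifs
  · simp
  · rw [abs_of_nonneg (by positivity)]
    exact le_of_eq (by ring)

lemma summable_sineCoef {K : ℝ} (hu : MemXb d 4 K u) : Summable (sineCoef u) := by
  refine Summable.of_abs (Summable.of_nonneg_of_le (fun _ => abs_nonneg _) (fun ν => ?_)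
    (summable_sineCoef_mul hu))
  exact le_mul_of_one_le_right (abs_nonneg _)
    (Finset.one_le_prod fun i _ => by nlinarith [sq_nonneg (ν i : ℝ)])

lemma sineCoef_sub {v w : (Fin d → ℝ) → ℝ} (hv : ContinuousOn v (unitCube d))
    (hw : ContinuousOn w (unitCube d)) (ν : Fin d → ℕ) :
    sineCoef (fun x => v x - w x) ν = sineCoef v ν - sineCoef w ν := by
  simp_rw [sineCoef, sub_mul]
  rw [integral_sub (integrable_mul_eigfn hv ν) (integrable_mul_eigfn hw ν), mul_sub]

/-- A continuous function with summable sine coefficients is the sum of its sine series. -/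
lemma eq_sineSeries {v : (Fin d → ℝ) → ℝ} (hv : ContinuousOn v (unitCube d))
    (hs : Summable (sineCoef v)) {x : Fin d → ℝ} (hx : x ∈ openCube d) :
    v x = ∑' ν, sineCoef v ν * eigfn ν x := by
  have hc := (continuous_sineSeries hs).continuousOn (s := unitCube d)
  refine sub_eq_zero.1 (eq_zero_of_sineCoef_eq_zero
    (v := fun x => v x - ∑' ν, sineCoef v ν * eigfn ν x) (hv.sub hc) (fun ν => ?_) hx)
  by_cases h : ∃ i, ν i = 0
  · obtain ⟨i, hi⟩ := h
    exact sineCoef_eq_zero_of_eq_zero _ hi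
  · push Not at h
    rw [sineCoef_sub hv hc, sineCoef_sineSeries hs h, sub_self]

lemma eigfn_eq_zero_of_mem_cubeBdry {x : Fin d → ℝ} (hx : x ∈ cubeBdry d) (ν : Fin d → ℕ) :
    eigfn ν x = 0 := by
  obtain ⟨-, i, hi | hi⟩ := hx
  · exact eigfn_eq_zero_of_sin i (by simp [hi])
  · exact eigfn_eq_zero_of_sin i (by
      rw [hi, mul_one, mul_comm]; exact Real.sin_nat_mul_pi _)

lemma mem_openCube_or_cubeBdry {x : Fin d → ℝ} (hx : x ∈ unitCube d) :
    x ∈ openCube d ∨ x ∈ cubeBdry d := by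
  by_cases h : ∃ i, x i = 0 ∨ x i = 1
  · exact Or.inr ⟨hx, h⟩
  · push Not at h
    exact Or.inl fun i _ => ⟨lt_of_le_of_ne (hx.1 i) (h i).1.symm, lt_of_le_of_ne (hx.2 i) (h i).2⟩

lemma eq_sineSeries_of_memXb {K : ℝ} (hu : MemXb d 4 K u) {x : Fin d → ℝ}
    (hx : x ∈ unitCube d) : u x = ∑' ν, sineCoef u ν * eigfn ν x := by
  have h0 := hu.1.2 0 fun _ => Nat.zero_le _
  rw [mderiv_zero] at h0
  obtain h | h := mem_openCube_or_cubeBdry hx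
  · exact eq_sineSeries h0.1 (summable_sineCoef hu) h
  · simp [h0.2 x h, eigfn_eq_zero_of_mem_cubeBdry h]

lemma pd_pd_eq_sineSeries {K : ℝ} (hu : MemXb d 4 K u) (i : Fin d) :
    Summable (fun ν => sineCoef u ν * (Real.pi * ν i) ^ 2) ∧
    ∀ x ∈ openCube d, pd d i (pd d i u) x =
      -∑' ν, sineCoef u ν * (Real.pi * ν i) ^ 2 * eigfn ν x := by
  have h1 : mderiv d (Function.update 0 i 2) u = pd d i (pd d i u) := by
    simpa [mderiv_zero] using mderiv_update_add_two i 0 (fun _ _ => rfl) u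
  have hc : ContinuousOn (pd d i (pd d i u)) (unitCube d) := by
    rw [← h1]
    refine (hu.1.2 _ fun k => ?_).1
    by_cases h : k = i
    · subst h; simp
    · simp [h]
  have h2 : ∀ ν, sineCoef (pd d i (pd d i u)) ν = -(sineCoef u ν * (Real.pi * ν i) ^ 2) := by
    intro ν
    have := sineCoef_mderiv_update hu.1 (i := i) (β := 0) (fun _ => Nat.zero_le _)
      (Nat.zero_le _) (fun _ _ => rfl) ν
    simp only [Pi.zero_apply, zero_add, h1, mderiv_zero] at this
    rw [this]; ring
  have hs : Summable (fun ν => sineCoef u ν * (Real.pi * ν i) ^ 2) := by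
    refine Summable.of_norm_bounded ((summable_sineCoef_mul hu).mul_left (Real.pi ^ 2))
      fun ν => ?_
    rw [Real.norm_eq_abs, abs_mul, abs_of_nonneg (sq_nonneg (Real.pi * ν i)), mul_pow,
      mul_left_comm]
    gcongr
    refine le_trans (by linarith : (ν i : ℝ) ^ 2 ≤ 1 + (ν i : ℝ) ^ 2) ?_
    rw [← Finset.mul_prod_erase _ _ (Finset.mem_univ i)]
    exact le_mul_of_one_le_right (by positivity)
      (Finset.one_le_prod fun j _ => by nlinarith [sq_nonneg (ν j : ℝ)])
  refine ⟨hs, fun x hx => ?_⟩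
  rw [eq_sineSeries hc (hs.neg.congr fun ν => by rw [h2]) hx, ← tsum_neg]
  exact tsum_congr fun ν => by rw [h2]; ring

lemma laplacian_eq_sineSeries {K : ℝ} (hu : MemXb d 4 K u) {x : Fin d → ℝ}
    (hx : x ∈ openCube d) :
    ∑ i, pd d i (pd d i u) x =
      -∑' ν, sineCoef u ν * (∑ i, (Real.pi * ν i) ^ 2) * eigfn ν x := by
  rw [Finset.sum_congr rfl fun i _ => (pd_pd_eq_sineSeries hu i).2 x hx, Finset.sum_neg_distrib,
    ← Summable.tsum_finsetSum fun i _ => summable_mul_eigfn (pd_pd_eq_sineSeries hu i).1 x]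
  simp only [Finset.mul_sum, Finset.sum_mul]

end

/-- The integral kernel of the Fourier multiplier `a` for the sine series on `[0,1]`. -/
noncomputable def sineKernel (a : ℕ → ℝ) (x y : ℝ) : ℝ :=
  ∑' n, 2 * a n * (Real.sin (Real.pi * n * x) * Real.sin (Real.pi * n * y))

lemma abs_sineKernel_term_le (a : ℕ → ℝ) (x y : ℝ) (n : ℕ) :
    |2 * a n * (Real.sin (Real.pi * n * x) * Real.sin (Real.pi * n * y))| ≤ 2 * |a n| := by
  rw [abs_mul, abs_mul, abs_mul, abs_two]
  exact mul_le_of_le_one_right (by positivity)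
    (mul_le_one₀ (Real.abs_sin_le_one _) (abs_nonneg _) (Real.abs_sin_le_one _))

lemma continuous_sineKernel {a : ℕ → ℝ} (ha : Summable fun n => |a n|) :
    Continuous fun p : ℝ × ℝ => sineKernel a p.1 p.2 :=
  continuous_tsum (fun n => by fun_prop) (ha.mul_left 2)
    fun n p => abs_sineKernel_term_le a p.1 p.2 n

lemma continuous_sineKernel_comp {a : ℕ → ℝ} (ha : Summable fun n => |a n|) {α : Type*}
    [TopologicalSpace α] {f g : α → ℝ} (hf : Continuous f) (hg : Continuous g) :
    Continuous fun z => sineKernel a (f z) (g z) :=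
  (continuous_sineKernel ha).comp₂ hf hg

lemma integrable_of_continuous_of_bound {α : Type*} [TopologicalSpace α] [MeasurableSpace α]
    [OpensMeasurableSpace α] [SecondCountableTopology α] {μ : Measure α} [IsFiniteMeasure μ]
    {f : α → ℝ} (hf : Continuous f) {C : ℝ} (hC : ∀ x, |f x| ≤ C) : Integrable f μ :=
  Integrable.of_bound hf.aestronglyMeasurable C (Filter.Eventually.of_forall hC)

/-- A product of one-dimensional sine multipliers acts on the sine series of a bounded function
with norm at most the product of the `L¹` norms of their kernels. -/
lemma abs_multiplier_sineSeries_le {a : Fin d → ℕ → ℝ} (ha : ∀ i, Summable fun n => |a i n|)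
    {M : Fin d → ℝ} (hM : ∀ i x, ∫ y in Set.Icc (0 : ℝ) 1, |sineKernel (a i) x y| ≤ M i)
    {V : (Fin d → ℝ) → ℝ} (hV : ContinuousOn V (unitCube d)) {K : ℝ}
    (hK : ∀ x ∈ unitCube d, |V x| ≤ K) (x : Fin d → ℝ) :
    |∑' ν, sineCoef V ν * (∏ i, a i (ν i)) * eigfn ν x| ≤ K * ∏ i, M i := by
  have hK0 : 0 ≤ K := (abs_nonneg _).trans (hK 0 ⟨le_rfl, zero_le_one⟩)
  let F : (Fin d → ℕ) → (Fin d → ℝ) → ℝ := fun ν y => V y * ∏ i, (2 * a i (ν i) *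
    (Real.sin (Real.pi * ν i * x i) * Real.sin (Real.pi * ν i * y i)))
  have hF : ∀ ν, sineCoef V ν * (∏ i, a i (ν i)) * eigfn ν x = ∫ y, F ν y ∂cubeMeas d := by
    intro ν
    simp only [F, sineCoef, eigfn, Finset.prod_mul_distrib, Finset.prod_const, Finset.card_univ,
      Fintype.card_fin]
    rw [show ∀ p I A E : ℝ, p * I * A * E = (p * A * E) * I by intros; ring, ← integral_const_mul]
    refine integral_congr_ae (Filter.Eventually.of_forall fun y => ?_)
    ring
  have hFc : ∀ ν, ContinuousOn (F ν) (unitCube d) := fun ν =>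
    hV.mul (continuous_finsetProd _ fun i _ => by fun_prop).continuousOn
  have hbd : ∀ ν, ∀ y ∈ unitCube d, |F ν y| ≤ K * ∏ i, (2 * |a i (ν i)|) := by
    intro ν y hy
    simp only [F]
    rw [abs_mul, Finset.abs_prod]
    gcongr with i
    · exact hK y hy
    · exact abs_sineKernel_term_le (a i) (x i) (y i) (ν i)
  have h2 : ∀ i, Summable fun n => |2 * (|a i n|)| := fun i => by
    simpa [abs_mul] using (ha i).mul_left 2
  have hsum := hasSum_integral_of_summable_integral_norm (μ := cubeMeas d) (F := F)
    (fun ν => integrable_cubeMeas (hFc ν))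
    (Summable.of_nonneg_of_le (fun ν => integral_nonneg fun _ => norm_nonneg _)
      (fun ν => (le_abs_self _).trans (abs_integral_cubeMeas_le fun y hy => by
        rw [abs_norm]; exact hbd ν y hy))
      ((summable_prod_of_summable h2).mul_left K))
  have hprod : ∀ y, ∑' ν, F ν y = V y * ∏ i, sineKernel (a i) (x i) (y i) := by
    intro y
    simp only [F]
    rw [tsum_mul_left, tsum_prod_of_summable (a := fun i n => 2 * a i n *
      (Real.sin (Real.pi * n * x i) * Real.sin (Real.pi * n * y i)))]
    · rfl
    · exact fun i => Summable.of_nonneg_of_le (fun _ => abs_nonneg _)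
        (abs_sineKernel_term_le (a i) (x i) (y i)) ((ha i).mul_left 2)
  simp_rw [hF]
  rw [hsum.tsum_eq]
  simp_rw [hprod]
  have hker : ∀ i, Continuous fun y : ℝ => sineKernel (a i) (x i) y := fun i =>
    continuous_sineKernel_comp (ha i) continuous_const continuous_id
  have hkerp : ContinuousOn (fun y : Fin d → ℝ => ∏ i, sineKernel (a i) (x i) (y i))
      (unitCube d) :=
    (continuous_finsetProd _ fun i _ => (hker i).comp (continuous_apply i)).continuousOn
  have hkera : ContinuousOn (fun y : Fin d → ℝ => K * ∏ i, |sineKernel (a i) (x i) (y i)|)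
      (unitCube d) :=
    (continuous_const.mul (continuous_finsetProd _ fun i _ =>
      ((hker i).comp (continuous_apply i)).abs)).continuousOn
  calc |∫ y, V y * ∏ i, sineKernel (a i) (x i) (y i) ∂cubeMeas d|
      ≤ ∫ y, |V y * ∏ i, sineKernel (a i) (x i) (y i)| ∂cubeMeas d :=
        abs_integral_le_integral_abs
    _ ≤ ∫ y, K * ∏ i, |sineKernel (a i) (x i) (y i)| ∂cubeMeas d := by
        refine integral_mono_ae (integrable_cubeMeas (hV.mul hkerp)).abs
          (integrable_cubeMeas hkera) (ae_cubeMeas fun y hy => ?_)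
        change |V y * ∏ i, sineKernel (a i) (x i) (y i)| ≤ _
        rw [abs_mul, Finset.abs_prod]
        exact mul_le_mul_of_nonneg_right (hK y hy) (Finset.prod_nonneg fun _ _ => abs_nonneg _)
    _ = K * ∏ i, ∫ y in Set.Icc (0 : ℝ) 1, |sineKernel (a i) (x i) y| := by
        rw [integral_const_mul, cubeMeas_eq_pi,
          integral_fintype_prod_eq_prod (fun i y => |sineKernel (a i) (x i) y|)]
    _ ≤ K * ∏ i, M i :=
        mul_le_mul_of_nonneg_left (Finset.prod_le_prod
          (fun i _ => integral_nonneg fun _ => abs_nonneg _) fun i _ => hM i (x i)) hK0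

section Poisson

variable {r : ℝ}

lemma hasSum_pow_mul_cos (hr0 : 0 ≤ r) (hr1 : r < 1) (θ : ℝ) :
    HasSum (fun n : ℕ => r ^ n * Real.cos (n * θ))
      ((1 - r * Real.cos θ) / (1 - 2 * r * Real.cos θ + r ^ 2)) := by
  set w : ℂ := r * Complex.exp (θ * Complex.I) with hw
  have hn : ‖w‖ < 1 := by
    rw [hw, norm_mul, Complex.norm_exp_ofReal_mul_I, mul_one, Complex.norm_real,
      Real.norm_of_nonneg hr0]
    exact hr1
  have h := Complex.hasSum_re (hasSum_geometric_of_norm_lt_one hn)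
  have hre : w.re = r * Real.cos θ := by
    rw [hw, Complex.re_ofReal_mul, Complex.exp_ofReal_mul_I_re]
  have him : w.im = r * Real.sin θ := by
    rw [hw, Complex.im_ofReal_mul, Complex.exp_ofReal_mul_I_im]
  have hsq : Complex.normSq (1 - w) = 1 - 2 * r * Real.cos θ + r ^ 2 := by
    rw [Complex.normSq_apply, Complex.sub_re, Complex.sub_im, hre, him, Complex.one_re,
      Complex.one_im]
    linear_combination r ^ 2 * Real.sin_sq_add_cos_sq θ
  rw [Complex.inv_re, hsq, Complex.sub_re, hre, Complex.one_re] at h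
  refine h.congr_fun fun n => ?_
  rw [hw, mul_pow, ← Complex.exp_nat_mul, ← Complex.ofReal_pow, ← mul_assoc,
    ← Complex.ofReal_natCast, ← Complex.ofReal_mul, Complex.re_ofReal_mul,
    Complex.exp_ofReal_mul_I_re]

/-- The sum `∑ rⁿ cos(π n z)`. -/
noncomputable def cosSum (r z : ℝ) : ℝ := ∑' n : ℕ, r ^ n * Real.cos (Real.pi * n * z)

lemma summable_abs_pow (hr0 : 0 ≤ r) (hr1 : r < 1) : Summable fun n : ℕ => |r ^ n| :=
  (summable_geometric_of_lt_one hr0 hr1).abs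

lemma abs_pow_mul_cos_le (hr0 : 0 ≤ r) (n : ℕ) (z : ℝ) : |r ^ n * Real.cos z| ≤ r ^ n := by
  rw [abs_mul, abs_of_nonneg (pow_nonneg hr0 n)]
  exact mul_le_of_le_one_right (pow_nonneg hr0 n) (Real.abs_cos_le_one _)

lemma summable_pow_mul_cos (hr0 : 0 ≤ r) (hr1 : r < 1) (z : ℝ) :
    Summable fun n : ℕ => r ^ n * Real.cos (Real.pi * n * z) :=
  Summable.of_norm_bounded (summable_geometric_of_lt_one hr0 hr1)
    fun n => abs_pow_mul_cos_le hr0 n _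

lemma continuous_cosSum (hr0 : 0 ≤ r) (hr1 : r < 1) : Continuous (cosSum r) :=
  continuous_tsum (fun n => by fun_prop) (summable_geometric_of_lt_one hr0 hr1)
    fun n z => abs_pow_mul_cos_le hr0 n _

lemma half_le_cosSum (hr0 : 0 ≤ r) (hr1 : r < 1) (z : ℝ) : 1 / 2 ≤ cosSum r z := by
  have h := hasSum_pow_mul_cos hr0 hr1 (Real.pi * z)
  have : cosSum r z = _ := (tsum_congr fun n => by
    rw [show Real.pi * n * z = n * (Real.pi * z) by ring]).trans h.tsum_eq
  have hc1 := Real.cos_le_one (Real.pi * z)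
  have hpos : 0 < 1 - 2 * r * Real.cos (Real.pi * z) + r ^ 2 := by
    nlinarith [mul_le_mul_of_nonneg_left hc1 hr0, sq_pos_of_pos (sub_pos.2 hr1)]
  rw [this, div_le_div_iff₀ two_pos hpos]
  nlinarith

lemma sineKernel_pow (hr0 : 0 ≤ r) (hr1 : r < 1) (x y : ℝ) :
    sineKernel (fun n => r ^ n) x y = cosSum r (x - y) - cosSum r (x + y) := by
  rw [cosSum, cosSum, ← (summable_pow_mul_cos hr0 hr1 _).tsum_sub
    (summable_pow_mul_cos hr0 hr1 _)]
  refine tsum_congr fun n => ?_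
  rw [mul_sub, mul_add, Real.cos_sub, Real.cos_add]
  ring

lemma integral_cosSum_add (hr0 : 0 ≤ r) (hr1 : r < 1) (x : ℝ) :
    ∫ y in Set.Icc (0 : ℝ) 1, (cosSum r (x - y) + cosSum r (x + y)) = 2 := by
  have h1 : ∀ y, cosSum r (x - y) + cosSum r (x + y) = ∑' n : ℕ, 2 * r ^ n *
      Real.cos (Real.pi * n * x) * Real.cos (Real.pi * n * y) := by
    intro y
    rw [cosSum, cosSum, ← (summable_pow_mul_cos hr0 hr1 _).tsum_add
      (summable_pow_mul_cos hr0 hr1 _)]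
    refine tsum_congr fun n => ?_
    rw [mul_sub, mul_add, Real.cos_sub, Real.cos_add]
    ring
  simp_rw [h1]
  have hb : ∀ (n : ℕ) (y : ℝ), |2 * r ^ n * Real.cos (Real.pi * n * x) *
      Real.cos (Real.pi * n * y)| ≤ 2 * r ^ n := by
    intro n y
    rw [mul_assoc, abs_mul, abs_mul, abs_mul, abs_of_nonneg (pow_nonneg hr0 n), abs_two]
    exact mul_le_of_le_one_right (by positivity)
      (mul_le_one₀ (Real.abs_cos_le_one _) (abs_nonneg _) (Real.abs_cos_le_one _))
  have hInt : ∀ n : ℕ, Integrable (fun y => 2 * r ^ n * Real.cos (Real.pi * n * x) *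
      Real.cos (Real.pi * n * y)) (volume.restrict (Set.Icc (0 : ℝ) 1)) := fun n =>
    integrable_of_continuous_of_bound (by fun_prop) (hb n)
  have hs := hasSum_integral_of_summable_integral_norm hInt
    (Summable.of_nonneg_of_le (fun n => integral_nonneg fun _ => norm_nonneg _) (fun n => ?_)
      ((summable_geometric_of_lt_one hr0 hr1).mul_left 2))
  · rw [← hs.tsum_eq, tsum_eq_single 0 fun n hn => ?_]
    · simp
    · have := integral_cos_int n
      rw [intervalIntegral.integral_of_le zero_le_one, ← integral_Icc_eq_integral_Ioc] at this
      rw [integral_const_mul]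
      simp only [Int.cast_natCast, Nat.cast_eq_zero, hn, if_false] at this
      rw [this, mul_zero]
  · refine (integral_mono (hInt n).norm (integrable_const _) (hb n)).trans ?_
    simp

lemma integral_abs_sineKernel_pow_le (hr0 : 0 ≤ r) (hr1 : r < 1) (x : ℝ) :
    ∫ y in Set.Icc (0 : ℝ) 1, |sineKernel (fun n => r ^ n) x y| ≤ 1 := by
  have hc := continuous_cosSum hr0 hr1
  have hi : Integrable (fun y => cosSum r (x - y) + cosSum r (x + y))
      (volume.restrict (Set.Icc (0 : ℝ) 1)) :=
    (by fun_prop : Continuous _).continuousOn.integrableOn_compact isCompact_Icc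
  have hi' : Integrable (fun y => |cosSum r (x - y) - cosSum r (x + y)|)
      (volume.restrict (Set.Icc (0 : ℝ) 1)) :=
    (by fun_prop : Continuous _).continuousOn.integrableOn_compact isCompact_Icc
  simp_rw [sineKernel_pow hr0 hr1]
  calc _ ≤ ∫ y in Set.Icc (0 : ℝ) 1, (cosSum r (x - y) + cosSum r (x + y) - 1) := by
        refine integral_mono hi' (hi.sub (integrable_const _)) fun y => ?_
        have h1 := half_le_cosSum hr0 hr1 (x - y)
        have h2 := half_le_cosSum hr0 hr1 (x + y)
        exact abs_le.2 ⟨by linarith, by linarith⟩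
    _ = 1 := by
        rw [integral_sub hi (integrable_const _), integral_cosSum_add hr0 hr1]
        simp; norm_num

/-- The symbol of the averaging operator
`g ↦ (1/6) ∫₀¹ (1 - s)³ (g (x + h s) + g (x - h s)) ds`, `h = 2^{-l}`. -/
noncomputable def avgSymb (l n : ℕ) : ℝ :=
  (1 / 3) * ∫ s in Set.Icc (0 : ℝ) 1, (1 - s) ^ 3 * Real.cos (Real.pi * n * (((2 : ℝ) ^ l)⁻¹ * s))

lemma trunc_eq (l n : ℕ) : trunc l n = (Real.pi * n) ^ 4 * avgSymb l n := by
  set h : ℝ := ((2 : ℝ) ^ l)⁻¹ with hh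
  have hpos : 0 < h := by positivity
  set a : ℝ := Real.pi * n * h with ha
  have hlin : ∀ t : ℝ, HasDerivAt (fun t => a * t) a t := fun t => by
    simpa using (hasDerivAt_id t).const_mul a
  have hone : ∀ t : ℝ, HasDerivAt (fun t : ℝ => 1 - t) (-1) t := fun t => by
    simpa using (hasDerivAt_id t).const_sub 1
  have hF : ∀ t : ℝ, HasDerivAt (fun t => a ^ 3 * ((1 - t) ^ 3 * Real.sin (a * t)) -
      3 * a ^ 2 * ((1 - t) ^ 2 * Real.cos (a * t)) - 6 * a * ((1 - t) * Real.sin (a * t)) +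
      6 * Real.cos (a * t)) (a ^ 4 * ((1 - t) ^ 3 * Real.cos (a * t))) t := by
    intro t
    have := ((((((hone t).pow 3).mul (hlin t).sin).const_mul (a ^ 3)).sub
      ((((hone t).pow 2).mul (hlin t).cos).const_mul (3 * a ^ 2))).sub
      (((hone t).mul (hlin t).sin).const_mul (6 * a))).add ((hlin t).cos.const_mul 6)
    refine this.congr_deriv ?_
    simp only [Pi.pow_apply]
    push_cast
    ring
  have hI : a ^ 4 * ∫ t in (0 : ℝ)..1, (1 - t) ^ 3 * Real.cos (a * t) =
      3 * a ^ 2 - 6 * (1 - Real.cos a) := by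
    rw [← intervalIntegral.integral_const_mul,
      intervalIntegral.integral_eq_sub_of_hasDerivAt (fun t _ => hF t)
        (Continuous.intervalIntegrable (by fun_prop) _ _)]
    simp
    ring
  have hm : avgSymb l n = (1 / 3) * ∫ t in (0 : ℝ)..1, (1 - t) ^ 3 * Real.cos (a * t) := by
    rw [avgSymb, intervalIntegral.integral_of_le zero_le_one, integral_Icc_eq_integral_Ioc]
    simp_rw [ha, ← mul_assoc]
    rfl
  have hsym : h ^ 2 * symb l n = 2 * (1 - Real.cos a) := by
    have h1 : a = 2 * (Real.pi * n / 2 ^ (l + 1)) := by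
      rw [ha, hh]; field_simp; ring
    have h2 : h * 2 ^ (l + 1) = 2 := by rw [hh]; field_simp; ring
    rw [symb, h1, Real.cos_two_mul, Real.cos_sq', ← mul_pow, ← mul_assoc, h2]
    ring
  rw [trunc, ← hh, div_eq_iff (by positivity)]
  have h4 : h ^ 2 ≠ 0 := by positivity
  refine mul_left_cancel₀ h4 ?_
  rw [mul_sub, hsym, hm]
  have : h ^ 2 * ((Real.pi * n) ^ 4 * ((1 / 3) *
      ∫ t in (0 : ℝ)..1, (1 - t) ^ 3 * Real.cos (a * t)) * h ^ 2) =
      (1 / 3) * (a ^ 4 * ∫ t in (0 : ℝ)..1, (1 - t) ^ 3 * Real.cos (a * t)) := by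
    rw [ha]; ring
  rw [this, hI, ha]
  ring

lemma integral_one_sub_pow_three : ∫ s in Set.Icc (0 : ℝ) 1, (1 - s) ^ 3 = 1 / 4 := by
  rw [integral_Icc_eq_integral_Ioc, ← intervalIntegral.integral_of_le zero_le_one,
    intervalIntegral.integral_comp_sub_left (fun s => s ^ 3)]
  norm_num [integral_pow]

lemma abs_avgSymb_le (l n : ℕ) : |avgSymb l n| ≤ 1 / 12 := by
  rw [avgSymb, abs_mul, abs_of_pos (by norm_num : (0 : ℝ) < 1 / 3)]
  have : |∫ s in Set.Icc (0 : ℝ) 1, (1 - s) ^ 3 * Real.cos (Real.pi * n * (((2 : ℝ) ^ l)⁻¹ * s))|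
      ≤ ∫ s in Set.Icc (0 : ℝ) 1, (1 - s) ^ 3 := by
    refine abs_integral_le_integral_abs.trans (setIntegral_mono_on
      (Continuous.integrableOn_Icc (by fun_prop)) (Continuous.integrableOn_Icc (by fun_prop))
      measurableSet_Icc fun s hs => ?_)
    have h : (0 : ℝ) ≤ (1 - s) ^ 3 := pow_nonneg (sub_nonneg.2 hs.2) 3
    rw [abs_mul, abs_of_nonneg h]
    exact mul_le_of_le_one_right h (Real.abs_cos_le_one _)
  rw [integral_one_sub_pow_three] at this
  linarith

lemma sineKernel_pow_mul_avgSymb (hr0 : 0 ≤ r) (hr1 : r < 1) (l : ℕ) (x y : ℝ) :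
    sineKernel (fun n => r ^ n * avgSymb l n) x y =
      ∫ s in Set.Icc (0 : ℝ) 1, (1 / 6) * (1 - s) ^ 3 *
        (sineKernel (fun n => r ^ n) (x + ((2 : ℝ) ^ l)⁻¹ * s) y +
          sineKernel (fun n => r ^ n) (x - ((2 : ℝ) ^ l)⁻¹ * s) y) := by
  set h : ℝ := ((2 : ℝ) ^ l)⁻¹ with hh
  let T : ℕ → ℝ → ℝ := fun n s => (1 / 6) * (1 - s) ^ 3 *
    (2 * r ^ n * (Real.sin (Real.pi * n * (x + h * s)) * Real.sin (Real.pi * n * y)) +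
      2 * r ^ n * (Real.sin (Real.pi * n * (x - h * s)) * Real.sin (Real.pi * n * y)))
  have hT : ∀ n, IntegrableOn (T n) (Set.Icc 0 1) := fun n =>
    Continuous.integrableOn_Icc (by fun_prop)
  have hsum : ∀ z, Summable fun n : ℕ => 2 * r ^ n *
      (Real.sin (Real.pi * n * z) * Real.sin (Real.pi * n * y)) := fun z =>
    Summable.of_norm_bounded ((summable_abs_pow hr0 hr1).mul_left 2)
      fun n => abs_sineKernel_term_le (fun n => r ^ n) z y n
  have hb : ∀ n, ∀ s ∈ Set.Icc (0 : ℝ) 1, ‖T n s‖ ≤ r ^ n := by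
    intro n s hs
    have h1 := abs_sineKernel_term_le (fun n => r ^ n) (x + h * s) y n
    have h2 := abs_sineKernel_term_le (fun n => r ^ n) (x - h * s) y n
    have h3 : 0 ≤ 1 - s := sub_nonneg.2 hs.2
    have h4 : (1 - s) ^ 3 ≤ 1 := pow_le_one₀ h3 (by linarith [hs.1])
    have h5 := pow_nonneg hr0 n
    rw [abs_of_nonneg h5] at h1 h2
    rw [Real.norm_eq_abs, abs_mul, abs_of_nonneg (by positivity)]
    calc _ ≤ 1 / 6 * 1 * (2 * r ^ n + 2 * r ^ n) := by
          gcongr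
          exact (abs_add_le _ _).trans (add_le_add h1 h2)
      _ ≤ r ^ n := by linarith
  have hs := hasSum_integral_of_summable_integral_norm hT
    (Summable.of_nonneg_of_le (fun n => integral_nonneg fun _ => norm_nonneg _) (fun n => ?_)
      (summable_geometric_of_lt_one hr0 hr1))
  · rw [sineKernel]
    refine Eq.trans (tsum_congr fun n => ?_) (hs.tsum_eq.trans (integral_congr_ae
      (Filter.Eventually.of_forall fun s => ?_)))
    · rw [avgSymb, ← hh, ← integral_const_mul, ← integral_const_mul, ← integral_const_mul,
        ← integral_mul_const]
      refine integral_congr_ae (Filter.Eventually.of_forall fun s => ?_)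
      simp only [T, mul_add, mul_sub, Real.sin_add, Real.sin_sub]
      ring
    · simp only [T, sineKernel]
      rw [tsum_mul_left, (hsum _).tsum_add (hsum _)]
  · refine (setIntegral_mono_on (hT n).norm (integrable_const _) measurableSet_Icc
      (hb n)).trans ?_
    simp

lemma integral_abs_sineKernel_pow_mul_avgSymb_le (hr0 : 0 ≤ r) (hr1 : r < 1) (l : ℕ) (x : ℝ) :
    ∫ y in Set.Icc (0 : ℝ) 1, |sineKernel (fun n => r ^ n * avgSymb l n) x y| ≤ 1 / 12 := by
  set h : ℝ := ((2 : ℝ) ^ l)⁻¹ with hh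
  set P : ℝ → ℝ → ℝ := sineKernel fun n => r ^ n with hPdef
  have hPc : ∀ {α : Type} [TopologicalSpace α] {f g : α → ℝ}, Continuous f → Continuous g →
      Continuous fun z => P (f z) (g z) := fun hf hg =>
    continuous_sineKernel_comp (summable_abs_pow hr0 hr1) hf hg
  clear_value P
  let G : ℝ → ℝ → ℝ := fun y s => (1 / 6) * (1 - s) ^ 3 * (|P (x + h * s) y| + |P (x - h * s) y|)
  have hG : Continuous (Function.uncurry G) := by
    have h1 : Continuous fun p : ℝ × ℝ => P (x + h * p.2) p.1 :=
      hPc (by fun_prop) (by fun_prop)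
    have h2 : Continuous fun p : ℝ × ℝ => P (x - h * p.2) p.1 :=
      hPc (by fun_prop) (by fun_prop)
    exact (by fun_prop : Continuous fun p : ℝ × ℝ => (1 / 6) * (1 - p.2) ^ 3).mul
      (h1.abs.add h2.abs)
  have hGi : Integrable (Function.uncurry G) ((volume.restrict (Set.Icc (0 : ℝ) 1)).prod
      (volume.restrict (Set.Icc (0 : ℝ) 1))) := by
    rw [Measure.prod_restrict]
    exact hG.continuousOn.integrableOn_compact (isCompact_Icc.prod isCompact_Icc)
  have hcont : Continuous fun y => sineKernel (fun n => r ^ n * avgSymb l n) x y := by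
    refine continuous_sineKernel_comp (Summable.of_nonneg_of_le (fun _ => abs_nonneg _)
      (fun n => ?_) (summable_abs_pow hr0 hr1)) continuous_const continuous_id
    rw [abs_mul]
    exact mul_le_of_le_one_right (abs_nonneg _) ((abs_avgSymb_le l n).trans (by norm_num))
  have hinner : ∀ s, ∫ y in Set.Icc (0 : ℝ) 1, (|P (x + h * s) y| + |P (x - h * s) y|) ≤ 2 := by
    intro s
    have hi : ∀ z, IntegrableOn (fun y => |P z y|) (Set.Icc 0 1) := fun z =>
      Continuous.integrableOn_Icc (hPc continuous_const continuous_id).abs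
    rw [integral_add (hi _) (hi _)]
    have h1 := integral_abs_sineKernel_pow_le hr0 hr1 (x + h * s)
    have h2 := integral_abs_sineKernel_pow_le hr0 hr1 (x - h * s)
    rw [← hPdef] at h1 h2
    linarith
  calc ∫ y in Set.Icc (0 : ℝ) 1, |sineKernel (fun n => r ^ n * avgSymb l n) x y|
      ≤ ∫ y in Set.Icc (0 : ℝ) 1, ∫ s in Set.Icc (0 : ℝ) 1, G y s := by
        refine integral_mono (Continuous.integrableOn_Icc hcont.abs) hGi.integral_prod_left
          fun y => ?_
        simp only
        rw [sineKernel_pow_mul_avgSymb hr0 hr1, ← hh, ← hPdef]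
        refine abs_integral_le_integral_abs.trans (setIntegral_mono_on
          (Continuous.integrableOn_Icc ?_) (Continuous.integrableOn_Icc
            (hG.comp (by fun_prop : Continuous fun s : ℝ => (y, s))))
          measurableSet_Icc fun s hs => ?_)
        · exact ((by fun_prop : Continuous fun s : ℝ => (1 / 6) * (1 - s) ^ 3).mul
            ((hPc (by fun_prop) continuous_const).add (hPc (by fun_prop) continuous_const))).abs
        · have h3 : 0 ≤ 1 - s := sub_nonneg.2 hs.2
          rw [abs_mul, abs_of_nonneg (by positivity)]
          exact mul_le_mul_of_nonneg_left (abs_add_le _ _) (by positivity)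
    _ = ∫ s in Set.Icc (0 : ℝ) 1, ∫ y in Set.Icc (0 : ℝ) 1, G y s := integral_integral_swap hGi
    _ ≤ ∫ s in Set.Icc (0 : ℝ) 1, (1 / 3) * (1 - s) ^ 3 := by
        refine setIntegral_mono_on hGi.integral_prod_right
          (Continuous.integrableOn_Icc (by fun_prop)) measurableSet_Icc fun s hs => ?_
        have h3 : 0 ≤ 1 - s := sub_nonneg.2 hs.2
        simp only [G]
        rw [integral_const_mul]
        nlinarith [hinner s, pow_nonneg h3 3]
    _ = 1 / 12 := by
        rw [integral_const_mul, integral_one_sub_pow_three]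
        norm_num

end Poisson

lemma abs_sineSeries_trunc_abel_le {K : ℝ} {u : (Fin d → ℝ) → ℝ} (hu : MemXb d 4 K u)
    {r : ℝ} (hr0 : 0 ≤ r) (hr1 : r < 1) (S : Finset (Fin d)) (lvl : Fin d → ℕ)
    (x : Fin d → ℝ) :
    |∑' ν, sineCoef u ν * (∏ s ∈ S, trunc (lvl s) (ν s)) * (∏ i, r ^ ν i) * eigfn ν x| ≤
      K / 12 ^ S.card := by
  classical
  let a : Fin d → ℕ → ℝ := fun i n => r ^ n * if i ∈ S then avgSymb (lvl i) n else 1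
  have ha : ∀ i, Summable fun n => |a i n| := fun i =>
    Summable.of_nonneg_of_le (fun _ => abs_nonneg _) (fun n => by
      rw [abs_mul]
      refine mul_le_of_le_one_right (abs_nonneg _) ?_
      split_ifs
      · exact (abs_avgSymb_le _ _).trans (by norm_num)
      · simp) (summable_abs_pow hr0 hr1)
  have hM : ∀ i x, ∫ y in Set.Icc (0 : ℝ) 1, |sineKernel (a i) x y| ≤
      if i ∈ S then 1 / 12 else 1 := by
    intro i x
    by_cases hi : i ∈ S
    · simpa [a, hi] using integral_abs_sineKernel_pow_mul_avgSymb_le hr0 hr1 (lvl i) x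
    · simpa [a, hi] using integral_abs_sineKernel_pow_le hr0 hr1 x
  have h := abs_multiplier_sineSeries_le ha hM (hu.1.2 _ (fourOn_le S)).1
    (hu.2 _ (fourOn_le S)) x
  have hprod : K * ∏ i, (if i ∈ S then (1 / 12 : ℝ) else 1) = K / 12 ^ S.card := by
    rw [Finset.prod_ite_mem, Finset.univ_inter, Finset.prod_const, one_div, inv_pow, div_eq_mul_inv]
  rw [hprod] at h
  refine le_of_eq_of_le (congrArg _ (tsum_congr fun ν => ?_)) h
  rw [sineCoef_mderiv_fourOn hu.1]
  simp_rw [trunc_eq]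
  simp only [a, Finset.prod_mul_distrib, Finset.prod_ite_mem, Finset.univ_inter]
  ring

lemma abs_sineSeries_trunc_le {K : ℝ} {u : (Fin d → ℝ) → ℝ} (hu : MemXb d 4 K u)
    (S : Finset (Fin d)) (lvl : Fin d → ℕ) (x : Fin d → ℝ) :
    |∑' ν, sineCoef u ν * (∏ s ∈ S, trunc (lvl s) (ν s)) * eigfn ν x| ≤ K / 12 ^ S.card := by
  have hsum : Summable fun ν => |sineCoef u ν * ∏ s ∈ S, trunc (lvl s) (ν s)| := by
    simpa [errCoef_empty] using
      (summable_errCoef (summable_sineCoef_mul hu) lvl (Finset.disjoint_empty_left S)).abs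
  let r : ℕ → ℝ := fun N => 1 - 1 / ((N : ℝ) + 1)
  have hr0 : ∀ N, 0 ≤ r N := fun N => by
    have : 1 / ((N : ℝ) + 1) ≤ 1 := by
      rw [div_le_one (by positivity)]; linarith [N.cast_nonneg (α := ℝ)]
    exact sub_nonneg.2 this
  have hr1 : ∀ N, r N < 1 := fun N => sub_lt_self _ (by positivity)
  have hr : Filter.Tendsto r Filter.atTop (nhds 1) := by
    simpa [r] using (tendsto_one_div_add_atTop_nhds_zero_nat (𝕜 := ℝ)).const_sub 1
  have hlim := tendsto_tsum_of_dominated_convergence (𝓕 := Filter.atTop)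
    (f := fun N ν => sineCoef u ν * (∏ s ∈ S, trunc (lvl s) (ν s)) * (∏ i, r N ^ ν i) *
      eigfn ν x)
    (g := fun ν => sineCoef u ν * (∏ s ∈ S, trunc (lvl s) (ν s)) * eigfn ν x) hsum
    (fun ν => by
      have : Filter.Tendsto (fun N => ∏ i, r N ^ ν i) Filter.atTop (nhds (∏ i : Fin d, 1 ^ ν i)) :=
        tendsto_finsetProd _ fun i _ => hr.pow (ν i)
      simpa using (this.const_mul (sineCoef u ν * ∏ s ∈ S, trunc (lvl s) (ν s))).mul_const
        (eigfn ν x))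
    (Filter.Eventually.of_forall fun N ν => by
      have hp0 : 0 ≤ ∏ i, r N ^ ν i := Finset.prod_nonneg fun i _ => pow_nonneg (hr0 N) _
      have hp1 : ∏ i, r N ^ ν i ≤ 1 := Finset.prod_le_one (fun i _ => pow_nonneg (hr0 N) _)
        fun i _ => pow_le_one₀ (hr0 N) (hr1 N).le
      rw [Real.norm_eq_abs, mul_assoc, abs_mul, abs_mul _ (eigfn ν x), abs_of_nonneg hp0]
      exact mul_le_of_le_one_right (abs_nonneg _)
        (mul_le_one₀ hp1 (abs_nonneg _) (abs_eigfn_le_one ν x)))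
  exact le_of_tendsto hlim.abs (Filter.Eventually.of_forall fun N =>
    abs_sineSeries_trunc_abel_le hu (hr0 N) (hr1 N) S lvl x)

end PoissonExpansion

/-- Error expansion on the grid for the central finite difference discretisation
of the Poisson problem (Theorem `expansion-on-grid`). -/
theorem poisson_error_expansion_on_grid (d : ℕ) (hd : 1 ≤ d) (K : ℝ) (hK : 0 < K)
    (f u : (Fin d → ℝ) → ℝ) (hu : MemXb d 4 K u)
    (heq : ∀ x ∈ openCube d, ∑ i, pd d i (pd d i u) x = f x)
    (hzero : ∀ x ∈ cubeBdry d, u x = 0) :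
    ∃ w : Finset (Fin d) → (Fin d → ℕ) → (Fin d → ℝ) → ℝ,
      (∀ (J : Finset (Fin d)) (lvl lvl' : Fin d → ℕ),
        (∀ j ∈ J, lvl j = lvl' j) → w J lvl = w J lvl') ∧
      (∀ J : Finset (Fin d), J.Nonempty → ∀ lvl : Fin d → ℕ,
        ContinuousOn (w J lvl) (Iplane d J lvl) ∧
        ∀ x ∈ Iplane d J lvl,
          |w J lvl x| ≤ K * (Nat.factorial J.card : ℝ) / (96 : ℝ) ^ J.card) ∧
      (∀ lvl : Fin d → ℕ, ∀ U : (Fin d → ℕ) → ℝ, IsFDPoisson d lvl f U →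
        ∀ i : Fin d → ℕ, IsGridIdx d lvl i →
          u (gridpt d lvl i) - U i =
            ∑ J ∈ Finset.univ.filter (fun J : Finset (Fin d) => J.Nonempty),
              w J lvl (gridpt d lvl i) * ∏ j ∈ J, hmesh d lvl j ^ 2) := by
  exact PoissonExpansion.expansion_of_sineSeries hd
    (PoissonExpansion.summable_sineCoef_mul hu)
    (fun x hx => PoissonExpansion.eq_sineSeries_of_memXb hu hx)
    (fun x hx => (heq x hx).symm.trans (PoissonExpansion.laplacian_eq_sineSeries hu hx))
    (PoissonExpansion.abs_sineSeries_trunc_le hu)
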